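/- arXiv:2403.08139 — 9 statements merged into one kernel-verified Lean document; each statement's English description precedes it below -/
import Mathlib

section
/- Let K be an algebraically closed field of characteristic 0 or p ≥ 5, fix A, B, a0, a1, a2, a3, a4, a5 ∈ K, and assume 4A³ + 27B² ≠ 0 (so that the plane cubic V(P) ⊂ ℙ²(K) is nonsingular). Then a point (x0 : y0 : z0 : w0) of C = V(P,Q) is a singular point of C if and only if w0 = 0 and there exists λ ∈ K such that (∂q/∂x, ∂q/∂y, ∂q/∂z) evaluated at (x0, y0, z0) equals λ · ((∂P/∂x, ∂P/∂y, ∂P/∂z) evaluated at (x0, y0, z0)), i.e., the tangent line of V(P) at (x0 : y0 : z0) is contained in the tangent space of V(q) there. -/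
open MvPolynomial

noncomputable section

/-- The homogeneous cubic `P = y²z − (x³ + A·x·z² + B·z³)` in `K[x,y,z,w]`
(variables `x = X 0`, `y = X 1`, `z = X 2`, `w = X 3`). -/
def Pcubic (K : Type*) [Field K] (A B : K) : MvPolynomial (Fin 4) K :=
  X 1 ^ 2 * X 2 - (X 0 ^ 3 + C A * X 0 * X 2 ^ 2 + C B * X 2 ^ 3)

/-- The quadratic form `q = a0x² + a1xy + a2xz + a3y² + a4yz + a5z²` viewed in `K[x,y,z,w]`. -/
def qForm (K : Type*) [Field K] (a0 a1 a2 a3 a4 a5 : K) : MvPolynomial (Fin 4) K :=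
  C a0 * X 0 ^ 2 + C a1 * X 0 * X 1 + C a2 * X 0 * X 2 +
    C a3 * X 1 ^ 2 + C a4 * X 1 * X 2 + C a5 * X 2 ^ 2

/-- The quadric `Q = w² − q`. -/
def Qquad (K : Type*) [Field K] (a0 a1 a2 a3 a4 a5 : K) : MvPolynomial (Fin 4) K :=
  X 3 ^ 2 - qForm K a0 a1 a2 a3 a4 a5

/-- The 2×4 Jacobian matrix of `(P, Q)` evaluated at a representative `v`. -/
def jacMat {K : Type*} [Field K] (P Q : MvPolynomial (Fin 4) K) (v : Fin 4 → K) :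
    Matrix (Fin 2) (Fin 4) K :=
  Matrix.of fun i k => eval v (pderiv k (![P, Q] i))

/-- over an algebraically closed field of characteristic 0 or ≥ 5, assuming
`4A³ + 27B² ≠ 0`, a point `(x0:y0:z0:w0)` of `C = V(P,Q)` is singular iff `w0 = 0` and the
gradient of `q` at `(x0,y0,z0)` is a scalar multiple of the gradient of `P` there. -/
theorem stmt0 {K : Type*} [Field K] [IsAlgClosed K]
    (hchar : ringChar K = 0 ∨ 5 ≤ ringChar K)
    (A B a0 a1 a2 a3 a4 a5 : K) (hAB : 4 * A ^ 3 + 27 * B ^ 2 ≠ 0)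
    (v : Fin 4 → K) (hv : v ≠ 0)
    (hP : eval v (Pcubic K A B) = 0)
    (hQ : eval v (Qquad K a0 a1 a2 a3 a4 a5) = 0) :
    (jacMat (Pcubic K A B) (Qquad K a0 a1 a2 a3 a4 a5) v).rank ≤ 1 ↔
      v 3 = 0 ∧ ∃ lam : K, ∀ k : Fin 3,
        eval v (pderiv (Fin.castSucc k) (qForm K a0 a1 a2 a3 a4 a5)) =
          lam * eval v (pderiv (Fin.castSucc k) (Pcubic K A B)) := by
  have hcast : ∀ n : ℕ, n.Prime → n < 5 → (n : K) ≠ 0 := by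
    intro n hn hn5 h0
    have hd := (ringChar.spec K n).1 h0
    rcases hchar with h | h
    · rw [h] at hd
      exact hn.ne_zero (Nat.eq_zero_of_zero_dvd hd)
    · have := Nat.le_of_dvd hn.pos hd
      omega
  have h2 : (2 : K) ≠ 0 := by exact_mod_cast hcast 2 Nat.prime_two (by norm_num)
  have h3 : (3 : K) ≠ 0 := by exact_mod_cast hcast 3 Nat.prime_three (by norm_num)
  have P0 : eval v (pderiv 0 (Pcubic K A B)) = -(3 * v 0 ^ 2 + A * v 2 ^ 2) := by
    simp [Pcubic, pderiv_X]; ring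
  have P1 : eval v (pderiv 1 (Pcubic K A B)) = 2 * v 1 * v 2 := by
    simp [Pcubic, pderiv_X]; try ring
  have P2 : eval v (pderiv 2 (Pcubic K A B)) =
      v 1 ^ 2 - (2 * A * v 0 * v 2 + 3 * B * v 2 ^ 2) := by
    simp [Pcubic, pderiv_X]; try ring
  have P3 : eval v (pderiv 3 (Pcubic K A B)) = 0 := by
    simp [Pcubic, pderiv_X]
  have Q3 : eval v (pderiv 3 (Qquad K a0 a1 a2 a3 a4 a5)) = 2 * v 3 := by
    simp [Qquad, qForm, pderiv_X]
  have Qk : ∀ k : Fin 3, eval v (pderiv (Fin.castSucc k) (Qquad K a0 a1 a2 a3 a4 a5)) =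
      - eval v (pderiv (Fin.castSucc k) (qForm K a0 a1 a2 a3 a4 a5)) := by
    intro k
    have hk : (3 : Fin 4) ≠ Fin.castSucc k := by
      revert k; decide
    simp [Qquad, pderiv_X, hk]
  -- the gradient of `P` does not vanish
  have hgrad : ¬ ∀ k : Fin 4, eval v (pderiv k (Pcubic K A B)) = 0 := by
    intro h
    have e0 := h 0
    have e1 := h 1
    have e2 := h 2
    rw [P0] at e0
    rw [P1] at e1
    rw [P2] at e2
    by_cases hz : v 2 = 0
    · have hx : v 0 = 0 := by
        simpa [hz, h3] using e0
      have hy : v 1 = 0 := by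
        simpa [hz] using e2
      have hw : v 3 = 0 := by
        simpa [Qquad, qForm, hx, hy, hz] using hQ
      apply hv
      funext i
      fin_cases i <;> simp [hx, hy, hz, hw]
    · have hy : v 1 = 0 := by
        simpa [hz, h2] using e1
      have e3 : 2 * A * v 0 + 3 * B * v 2 = 0 := by
        apply mul_right_cancel₀ hz
        rw [hy] at e2
        linear_combination -e2
      apply hAB
      apply mul_right_cancel₀ (pow_ne_zero 2 hz)
      linear_combination (-4 * A ^ 2) * e0 - (2 * A * v 0 - 3 * B * v 2) * 3 * e3
  have row0 : ∀ k, jacMat (Pcubic K A B) (Qquad K a0 a1 a2 a3 a4 a5) v 0 k =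
      eval v (pderiv k (Pcubic K A B)) := fun k => rfl
  have row1 : ∀ k, jacMat (Pcubic K A B) (Qquad K a0 a1 a2 a3 a4 a5) v 1 k =
      eval v (pderiv k (Qquad K a0 a1 a2 a3 a4 a5)) := fun k => rfl
  constructor
  · intro hr
    have hdep : ¬ LinearIndependent K
        (jacMat (Pcubic K A B) (Qquad K a0 a1 a2 a3 a4 a5) v).row := by
      intro hli
      have := hli.rank_matrix
      simp at this
      omega
    have hrow : (jacMat (Pcubic K A B) (Qquad K a0 a1 a2 a3 a4 a5) v).row =
        ![fun k => eval v (pderiv k (Pcubic K A B)),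
          fun k => eval v (pderiv k (Qquad K a0 a1 a2 a3 a4 a5))] := by
      funext i
      fin_cases i <;> rfl
    rw [hrow, LinearIndependent.pair_iff] at hdep
    push Not at hdep
    obtain ⟨s, t, hst, hne⟩ := hdep
    have hk : ∀ k, s * eval v (pderiv k (Pcubic K A B)) +
        t * eval v (pderiv k (Qquad K a0 a1 a2 a3 a4 a5)) = 0 := by
      intro k
      exact congrFun hst k
    have ht : t ≠ 0 := by
      intro ht
      have hs : s ≠ 0 := fun hs => hne hs ht
      apply hgrad
      intro k
      simpa [ht, hs] using hk k
    refine ⟨?_, s / t, ?_⟩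
    · have := hk 3
      rw [P3, Q3] at this
      simpa [ht, h2] using this
    · intro k
      have := hk (Fin.castSucc k)
      rw [Qk] at this
      field_simp
      linear_combination -this
  · rintro ⟨hw, lam, hl⟩
    have hM : jacMat (Pcubic K A B) (Qquad K a0 a1 a2 a3 a4 a5) v =
        Matrix.vecMulVec ![1, -lam] (fun k => eval v (pderiv k (Pcubic K A B))) := by
      ext i k
      fin_cases i
      · simp [Matrix.vecMulVec_apply, row0]
      · simp only [Fin.mk_one, Matrix.vecMulVec_apply, row1]
        refine Fin.lastCases ?_ (fun j => ?_) k
        · change eval v (pderiv 3 _) = _ * eval v (pderiv 3 _)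
          rw [P3, Q3, hw]; simp
        · rw [Qk, hl]; simp
    rw [hM]
    exact Matrix.rank_vecMulVec_le _ _

end
end

section
/- Let K be an algebraically closed field of characteristic 0 or p ≥ 5 and fix A, B, a0, a1, a2, a3, a4, a5 ∈ K. The projective curve C = V(P,Q) ⊂ ℙ³(K) is nonsingular if and only if 4A³ + 27B² ≠ 0 (equivalently, the plane cubic V(P) ⊂ ℙ²(K) is nonsingular) and the set of points of ℙ²(K) at which both P and q vanish has exactly six elements. -/
open MvPolynomial

noncomputable section

/-- The homogeneous cubic `P` as a polynomial in the three variables `x, y, z`. -/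
def Pcubic3 (K : Type*) [Field K] (A B : K) : MvPolynomial (Fin 3) K :=
  X 1 ^ 2 * X 2 - (X 0 ^ 3 + C A * X 0 * X 2 ^ 2 + C B * X 2 ^ 3)

/-- The quadratic form `q` as a polynomial in the three variables `x, y, z`. -/
def qForm3 (K : Type*) [Field K] (a0 a1 a2 a3 a4 a5 : K) : MvPolynomial (Fin 3) K :=
  C a0 * X 0 ^ 2 + C a1 * X 0 * X 1 + C a2 * X 0 * X 2 +
    C a3 * X 1 ^ 2 + C a4 * X 1 * X 2 + C a5 * X 2 ^ 2

section helpers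
variable {K : Type*} [Field K]
theorem rank_le_one_minors (M : Matrix (Fin 2) (Fin 4) K) :
    M.rank ≤ 1 ↔ ∀ i j, M 0 i * M 1 j = M 0 j * M 1 i := by
  have h1 : LinearIndependent K M.row ↔ ¬ M.rank ≤ 1 := by
    rw [linearIndependent_iff_card_eq_finrank_span, Set.finrank, ← Matrix.rank_eq_finrank_span_row]
    have := M.rank_le_height
    simp only [Fintype.card_fin]
    omega
  rw [← not_iff_not, ← h1]
  have h2 : M.row = ![M 0, M 1] := by
    ext i j; fin_cases i <;> rfl
  rw [h2, LinearIndependent.pair_iff]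
  constructor
  · intro h hc
    have h0 : M 0 ≠ 0 := by
      intro h0
      have := h 1 0 (by simp [h0])
      simp at this
    apply h0
    ext i
    have := h (M 1 i) (-(M 0 i)) (by
      ext j
      simp
      linear_combination (hc j i))
    simpa using this.2
  · intro h s t hst
    by_contra hne
    apply h
    intro i j
    have hi := congrFun hst i
    have hj := congrFun hst j
    simp at hi hj
    by_cases hs : s = 0
    · subst hs
      have ht : t ≠ 0 := by simpa using hne
      simp [ht] at hi hj
      simp [hi, hj]
    · apply mul_left_cancel₀ hs
      linear_combination (M 1 j) * hi - M 1 i * hj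

theorem evP (A B : K) (v : Fin 4 → K) : eval v (Pcubic K A B) =
    v 1 ^ 2 * v 2 - (v 0 ^ 3 + A * v 0 * v 2 ^ 2 + B * v 2 ^ 3) := by
  simp [Pcubic]
theorem evQ (a0 a1 a2 a3 a4 a5 : K) (v : Fin 4 → K) : eval v (Qquad K a0 a1 a2 a3 a4 a5) =
    v 3 ^ 2 - (a0 * v 0 ^ 2 + a1 * v 0 * v 1 + a2 * v 0 * v 2 +
    a3 * v 1 ^ 2 + a4 * v 1 * v 2 + a5 * v 2 ^ 2) := by
  simp [Qquad, qForm]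
theorem evP3 (A B : K) (v : Fin 3 → K) : eval v (Pcubic3 K A B) =
    v 1 ^ 2 * v 2 - (v 0 ^ 3 + A * v 0 * v 2 ^ 2 + B * v 2 ^ 3) := by
  simp [Pcubic3]
theorem evq3 (a0 a1 a2 a3 a4 a5 : K) (v : Fin 3 → K) : eval v (qForm3 K a0 a1 a2 a3 a4 a5) =
    (a0 * v 0 ^ 2 + a1 * v 0 * v 1 + a2 * v 0 * v 2 +
    a3 * v 1 ^ 2 + a4 * v 1 * v 2 + a5 * v 2 ^ 2) := by
  simp [qForm3]

theorem jac_eq (A B a0 a1 a2 a3 a4 a5 : K) (v : Fin 4 → K) :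
    jacMat (Pcubic K A B) (Qquad K a0 a1 a2 a3 a4 a5) v =
    !![-(3 * v 0 ^ 2 + A * v 2 ^ 2), 2 * v 1 * v 2, v 1 ^ 2 - 2 * A * v 0 * v 2 - 3 * B * v 2 ^ 2, 0;
      -(2 * a0 * v 0 + a1 * v 1 + a2 * v 2), -(a1 * v 0 + 2 * a3 * v 1 + a4 * v 2),
      -(a2 * v 0 + a4 * v 1 + 2 * a5 * v 2), 2 * v 3] := by
  ext i j
  fin_cases i <;> fin_cases j <;>
    simp [jacMat, Pcubic, Qquad, qForm, pderiv_X, Derivation.leibniz_pow] <;> ring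

theorem minors_aux (x y p0 p1 p2 g0 g1 g2 : K) (hp : x * p0 + y * p1 + p2 = 0)
    (hg : x * g0 + y * g1 + g2 = 0) (h : p0 * g1 = p1 * g0) (i j : Fin 4) :
    !![p0, p1, p2, 0; g0, g1, g2, 0] 0 i * !![p0, p1, p2, 0; g0, g1, g2, 0] 1 j =
    !![p0, p1, p2, 0; g0, g1, g2, 0] 0 j * !![p0, p1, p2, 0; g0, g1, g2, 0] 1 i := by
  obtain rfl : p2 = -x * p0 - y * p1 := by linear_combination hp
  obtain rfl : g2 = -x * g0 - y * g1 := by linear_combination hg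
  fin_cases i <;> fin_cases j <;> simp
  · linear_combination h
  · linear_combination -y * h
  · linear_combination -h
  · linear_combination x * h
  · linear_combination y * h
  · linear_combination -x * h

/-- affine transversality -/
def TransAt (A a0 a1 a2 a3 a4 x y : K) : Prop :=
  (3 * x ^ 2 + A) * (a1 * x + 2 * a3 * y + a4) + 2 * y * (2 * a0 * x + a1 * y + a2) ≠ 0

theorem nonsing_iff [IsAlgClosed K] (h2 : (2:K) ≠ 0) (h3 : (3:K) ≠ 0)
    (A B a0 a1 a2 a3 a4 a5 : K) :
    (∀ v : Fin 4 → K, v ≠ 0 →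
        eval v (Pcubic K A B) = 0 → eval v (Qquad K a0 a1 a2 a3 a4 a5) = 0 →
        ¬ (jacMat (Pcubic K A B) (Qquad K a0 a1 a2 a3 a4 a5) v).rank ≤ 1) ↔
      (4 * A ^ 3 + 27 * B ^ 2 ≠ 0 ∧ (a3 = 0 → a1 ≠ 0) ∧
        ∀ x y : K, y ^ 2 = x ^ 3 + A * x + B →
          a0 * x ^ 2 + a1 * x * y + a2 * x + a3 * y ^ 2 + a4 * y + a5 = 0 →
          TransAt A a0 a1 a2 a3 a4 x y) := by
  simp only [rank_le_one_minors, jac_eq, evP, evQ]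
  constructor
  · intro h
    refine ⟨?_, ?_, ?_⟩
    · intro hD
      obtain ⟨x, hx, hx'⟩ : ∃ x : K, x ^ 3 + A * x + B = 0 ∧ 3 * x ^ 2 + A = 0 := by
        by_cases hA : A = 0
        · subst hA
          have : B = 0 := by
            have h27 : (27 : K) ≠ 0 := by
              have : (27 : K) = 3 ^ 3 := by norm_num
              rw [this]; exact pow_ne_zero _ h3
            simpa [h27] using hD
          exact ⟨0, by simp [this]⟩
        · refine ⟨-3 * B / (2 * A), ?_, ?_⟩
          · field_simp
            linear_combination (-B) * hD
          · field_simp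
            linear_combination hD
      obtain ⟨w, hw⟩ := IsAlgClosed.exists_pow_nat_eq (a0 * x ^ 2 + a2 * x + a5) (n := 2) (by norm_num)
      refine h ![x, 0, 1, w] (fun h0 => by simpa using congrFun h0 2) ?_ ?_ ?_
      · simp; linear_combination -hx
      · simp; linear_combination hw
      · have e3 : - (2 * A * x) - 3 * B = 0 := by linear_combination - 3 * hx + x * hx'
        have e1 : -A + -(3*x^2) = 0 := by linear_combination - hx'
        intro i j
        fin_cases i <;> fin_cases j <;> simp [e1, e3]
    · intro h3 h1
      subst h3 h1
      refine h ![0, 1, 0, 0] (fun h0 => by simpa using congrFun h0 1) (by simp) (by simp) ?_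
      intro i j
      fin_cases i <;> fin_cases j <;> simp
    · intro x y hP hq ht
      refine h ![x, y, 1, 0] (fun h0 => by simpa using congrFun h0 2) ?_ ?_ ?_
      · simp; linear_combination hP
      · simp; linear_combination -hq
      · intro i j
        have := minors_aux x y (-(3 * x ^ 2 + A)) (2 * y) (y ^ 2 - 2 * A * x - 3 * B)
          (-(2 * a0 * x + a1 * y + a2)) (-(a1 * x + 2 * a3 * y + a4)) (-(a2 * x + a4 * y + 2 * a5))
          (by linear_combination 3 * hP) (by linear_combination (-2) * hq)
          (by linear_combination ht) i j
        simpa using this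
  · rintro ⟨hD, hO, ht⟩ v hv hP hQ hm
    have m01 := hm 0 1
    have m02 := hm 0 2
    have m12 := hm 1 2
    have m03 := hm 0 3
    have m13 := hm 1 3
    have m23 := hm 2 3
    simp [h2] at m01 m02 m12 m03 m13 m23
    by_cases hw : v 3 = 0
    · simp [hw] at hQ
      by_cases hz : v 2 = 0
      · simp [hz] at hP hQ m02 m12
        have hy : v 1 ≠ 0 := by
          intro hy
          apply hv
          ext i; fin_cases i <;> simp [*]
        simp [hP, hy] at hQ m02 m12
        exact hO hQ m02
      · obtain ⟨x, hx⟩ : ∃ x, v 0 = x * v 2 := ⟨v 0 / v 2, by field_simp⟩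
        obtain ⟨y, hy⟩ : ∃ y, v 1 = y * v 2 := ⟨v 1 / v 2, by field_simp⟩
        rw [hx, hy] at hP hQ m01
        refine ht x y ?_ ?_ ?_
        · apply mul_left_cancel₀ (pow_ne_zero 3 hz)
          linear_combination hP
        · apply mul_left_cancel₀ (pow_ne_zero 2 hz)
          linear_combination -hQ
        · apply mul_left_cancel₀ (pow_ne_zero 3 hz)
          linear_combination m01
    · simp [hw] at m03 m13 m23
      by_cases hz : v 2 = 0
      · simp [hz] at hP m23
        simp [hz, hP, m23, hw] at hQ
      · simp [hz] at m13
        simp [m13] at m23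
        have m23' : 2 * A * v 0 + 3 * B * v 2 = 0 := by
          apply mul_left_cancel₀ hz
          linear_combination -m23
        apply hD
        apply mul_left_cancel₀ (pow_ne_zero 2 hz)
        linear_combination (-4 * A ^ 2) * m03 + 3 * (3 * B * v 2 - 2 * A * v 0) * m23'

/-- the fibre of the affine intersection over `x` -/
def fib (f u v : Polynomial K) (x : K) : Finset K :=
  open Classical in
  (Polynomial.nthRoots 2 (f.eval x)).toFinset.filter (fun y => u.eval x + v.eval x * y = 0)

theorem mem_fib (f u v : Polynomial K) (x y : K) :
    y ∈ fib f u v x ↔ y ^ 2 = f.eval x ∧ u.eval x + v.eval x * y = 0 := by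
  simp [fib, Polynomial.mem_nthRoots]

/-- transversality -/
def TT (f u v : Polynomial K) (x y : K) : Prop :=
  f.derivative.eval x * v.eval x +
    2 * y * (u.derivative.eval x + v.derivative.eval x * y) ≠ 0

theorem local_count [IsAlgClosed K] (h2 : (2:K) ≠ 0) (f u v : Polynomial K)
    (hN : u ^ 2 - f * v ^ 2 ≠ 0) (x : K) (hx : (u ^ 2 - f * v ^ 2).IsRoot x) :
    (fib f u v x).card ≤ (u ^ 2 - f * v ^ 2).rootMultiplicity x ∧
    ((fib f u v x).card = (u ^ 2 - f * v ^ 2).rootMultiplicity x ↔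
      ∀ y ∈ fib f u v x, TT f u v x y) := by
  have hx' : u.eval x ^ 2 - f.eval x * v.eval x ^ 2 = 0 := by
    simpa [Polynomial.IsRoot] using hx
  by_cases hv : v.eval x = 0
  · have hu : u.eval x = 0 := by simpa [hv] using hx'
    obtain ⟨u1, rfl⟩ := Polynomial.dvd_iff_isRoot.mpr hu
    obtain ⟨v1, rfl⟩ := Polynomial.dvd_iff_isRoot.mpr hv
    have hfac : ((Polynomial.X - Polynomial.C x) * u1) ^ 2 -
        f * ((Polynomial.X - Polynomial.C x) * v1) ^ 2 =
        (u1 ^ 2 - f * v1 ^ 2) * (Polynomial.X - Polynomial.C x) ^ 2 := by ring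
    have hM : u1 ^ 2 - f * v1 ^ 2 ≠ 0 := by
      intro h; rw [hfac, h] at hN; simp at hN
    rw [hfac, Polynomial.rootMultiplicity_mul_X_sub_C_pow hM]
    obtain ⟨y, hy⟩ := IsAlgClosed.exists_pow_nat_eq (f.eval x) (n := 2) (by norm_num)
    have hmem : ∀ t, t ∈ fib f ((Polynomial.X - Polynomial.C x) * u1)
        ((Polynomial.X - Polynomial.C x) * v1) x ↔ t = y ∨ t = -y := by
      intro t
      rw [mem_fib, ← hy, sq_eq_sq_iff_eq_or_eq_neg]
      simp
    have hmult : (u1 ^ 2 - f * v1 ^ 2).rootMultiplicity x = 0 ↔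
        u1.eval x ^ 2 - y ^ 2 * v1.eval x ^ 2 ≠ 0 := by
      rw [Polynomial.rootMultiplicity_eq_zero_iff]
      simp [Polynomial.IsRoot, hy, hM]
    classical
    by_cases hy0 : y = 0
    · have hF : fib f ((Polynomial.X - Polynomial.C x) * u1)
        ((Polynomial.X - Polynomial.C x) * v1) x = {0} := by
        ext t; rw [hmem]; simp [hy0]
      rw [hF]
      refine ⟨by simp, ?_⟩
      simp [TT]
    · have hF : fib f ((Polynomial.X - Polynomial.C x) * u1)
        ((Polynomial.X - Polynomial.C x) * v1) x = {y, -y} := by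
        ext t; rw [hmem]; simp
      have hne : y ≠ -y := by
        intro h
        have : 2 * y = 0 := by linear_combination h
        simp [h2, hy0] at this
      rw [hF, Finset.card_pair hne]
      refine ⟨by omega, ?_⟩
      have : (2 = Polynomial.rootMultiplicity x (u1 ^ 2 - f * v1 ^ 2) + 2) ↔
        (u1 ^ 2 - f * v1 ^ 2).rootMultiplicity x = 0 := by omega
      rw [this, hmult]
      have h' : u1.eval x ^ 2 - y ^ 2 * v1.eval x ^ 2 =
        (u1.eval x + v1.eval x * y) * (u1.eval x + -(v1.eval x * y)) := by ring
      rw [h']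
      simp [TT, h2, hy0]
  · have hF : fib f u v x = {- u.eval x / v.eval x} := by
      ext t
      rw [mem_fib, Finset.mem_singleton]
      constructor
      · rintro ⟨-, h⟩
        field_simp
        linear_combination h
      · rintro rfl
        constructor
        · field_simp; linear_combination hx'
        · field_simp; ring
    have h1 := Polynomial.one_lt_rootMultiplicity_iff_isRoot (t := x) hN
    have h0 := (Polynomial.rootMultiplicity_pos hN).mpr hx
    rw [hF]
    refine ⟨by rw [Finset.card_singleton]; exact h0, ?_⟩
    have : (1 = Polynomial.rootMultiplicity x (u ^ 2 - f * v ^ 2)) ↔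
        ¬ (1 < (u ^ 2 - f * v ^ 2).rootMultiplicity x) := by omega
    simp only [Finset.card_singleton, this, h1, hx, true_and, Finset.mem_singleton, forall_eq, TT,
      ne_eq, not_iff_not]
    obtain ⟨y, hy⟩ : ∃ y, u.eval x = - v.eval x * y := ⟨-u.eval x / v.eval x, by field_simp⟩
    have hy' : - u.eval x / v.eval x = y := by rw [hy]; field_simp
    have hfy : f.eval x = y ^ 2 := by
      apply mul_left_cancel₀ (pow_ne_zero 2 hv)
      rw [hy] at hx'
      linear_combination -hx'
    rw [hy']
    simp [Polynomial.IsRoot, Polynomial.derivative_pow, hy, hfy]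
    constructor
    · intro h
      apply mul_left_cancel₀ (neg_ne_zero.mpr hv)
      linear_combination h
    · intro h
      linear_combination (-v.eval x) * h

theorem global_count [IsAlgClosed K] (h2 : (2:K) ≠ 0) (f u v : Polynomial K)
    (hN : u ^ 2 - f * v ^ 2 ≠ 0) :
    ∃ n : ℕ, {p : Σ _ : K, K | p.2 ^ 2 = f.eval p.1 ∧ u.eval p.1 + v.eval p.1 * p.2 = 0}.encard
        = n ∧
      n ≤ (u ^ 2 - f * v ^ 2).natDegree ∧ (n = (u ^ 2 - f * v ^ 2).natDegree ↔
      ∀ x y : K, y ^ 2 = f.eval x → u.eval x + v.eval x * y = 0 → TT f u v x y) := by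
  classical
  have hroot : ∀ x y : K, y ^ 2 = f.eval x → u.eval x + v.eval x * y = 0 →
      (u ^ 2 - f * v ^ 2).IsRoot x := by
    intro x y h h'
    simp only [Polynomial.IsRoot, Polynomial.eval_sub, Polynomial.eval_mul, Polynomial.eval_pow]
    rw [← h]
    linear_combination (u.eval x - v.eval x * y) * h'
  have hS : {p : Σ _ : K, K | p.2 ^ 2 = f.eval p.1 ∧ u.eval p.1 + v.eval p.1 * p.2 = 0} =
      ((u ^ 2 - f * v ^ 2).roots.toFinset.sigma (fib f u v) : Finset (Σ _ : K, K)) := by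
    ext ⟨x, y⟩
    simp only [Set.mem_ofPred_eq, Finset.mem_coe, Finset.mem_sigma, mem_fib, Multiset.mem_toFinset,
      Polynomial.mem_roots hN]
    exact ⟨fun h => ⟨hroot x y h.1 h.2, h⟩, fun h => h.2⟩
  have hdeg : ∑ x ∈ (u ^ 2 - f * v ^ 2).roots.toFinset, (u ^ 2 - f * v ^ 2).rootMultiplicity x
      = (u ^ 2 - f * v ^ 2).natDegree := by
    rw [← IsAlgClosed.card_roots_eq_natDegree, ← Multiset.toFinset_sum_count_eq]
    simp [Polynomial.count_roots]
  have hloc : ∀ x ∈ (u ^ 2 - f * v ^ 2).roots.toFinset, _ := fun x hx =>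
    local_count h2 f u v hN x (by simpa [hN] using hx)
  refine ⟨_, by rw [hS, Set.encard_coe_eq_coe_finsetCard], ?_, ?_⟩
  · rw [Finset.card_sigma, ← hdeg]
    exact Finset.sum_le_sum fun x hx => (hloc x hx).1
  · rw [Finset.card_sigma, ← hdeg, Finset.sum_eq_sum_iff_of_le fun x hx => (hloc x hx).1]
    constructor
    · intro h x y hy hu
      have hx : x ∈ (u ^ 2 - f * v ^ 2).roots.toFinset := by
        simpa [Polynomial.mem_roots hN] using hroot x y hy hu
      exact (hloc x hx).2.mp (h x hx) y ((mem_fib ..).mpr ⟨hy, hu⟩)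
    · intro h x hx
      refine (hloc x hx).2.mpr fun y hy => ?_
      rw [mem_fib] at hy
      exact h x y hy.1 hy.2

/-- the Weierstrass cubic in one variable -/
def fP (A B : K) : Polynomial K :=
  Polynomial.X ^ 3 + Polynomial.C A * Polynomial.X + Polynomial.C B

/-- the `y`-free part of `q` modulo the cubic -/
def uP (A B a0 a2 a3 a5 : K) : Polynomial K :=
  Polynomial.C a3 * fP A B + Polynomial.C a0 * Polynomial.X ^ 2 + Polynomial.C a2 * Polynomial.X
    + Polynomial.C a5

/-- the coefficient of `y` in `q` -/
def vP (a1 a4 : K) : Polynomial K := Polynomial.C a1 * Polynomial.X + Polynomial.C a4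

/-- affine intersection -/
def Saff (A B a0 a1 a2 a3 a4 a5 : K) : Set (Σ _ : K, K) :=
  {p | p.2 ^ 2 = p.1 ^ 3 + A * p.1 + B ∧
    a0 * p.1 ^ 2 + a1 * p.1 * p.2 + a2 * p.1 + a3 * p.2 ^ 2 + a4 * p.2 + a5 = 0}

theorem Saff_eq (A B a0 a1 a2 a3 a4 a5 : K) : Saff A B a0 a1 a2 a3 a4 a5 =
    {p : Σ _ : K, K | p.2 ^ 2 = (fP A B).eval p.1 ∧
      (uP A B a0 a2 a3 a5).eval p.1 + (vP a1 a4).eval p.1 * p.2 = 0} := by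
  ext ⟨x, y⟩
  simp only [Saff, Set.mem_ofPred_eq, fP, uP, vP, Polynomial.eval_add, Polynomial.eval_mul,
    Polynomial.eval_pow, Polynomial.eval_C, Polynomial.eval_X]
  refine and_congr_right fun h => ?_
  rw [← h]
  constructor <;> intro h' <;> linear_combination h'

theorem forall_trans_iff (A B a0 a1 a2 a3 a4 a5 : K) :
    (∀ x y : K, y ^ 2 = x ^ 3 + A * x + B →
          a0 * x ^ 2 + a1 * x * y + a2 * x + a3 * y ^ 2 + a4 * y + a5 = 0 →
          TransAt A a0 a1 a2 a3 a4 x y) ↔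
    (∀ x y : K, y ^ 2 = (fP A B).eval x →
      (uP A B a0 a2 a3 a5).eval x + (vP a1 a4).eval x * y = 0 →
      TT (fP A B) (uP A B a0 a2 a3 a5) (vP a1 a4) x y) := by
  refine forall₂_congr fun x y => ?_
  have h := Set.ext_iff.mp (Saff_eq A B a0 a1 a2 a3 a4 a5) ⟨x, y⟩
  simp only [Saff, Set.mem_ofPred_eq] at h
  rw [← and_imp, ← and_imp, h]
  refine imp_congr_right fun _ => ?_
  unfold TransAt TT
  apply not_congr
  simp [fP, uP, vP]
  constructor <;> intro h' <;> linear_combination h'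

theorem aff_count [IsAlgClosed K] (h2 : (2:K) ≠ 0) (A B a0 a1 a2 a3 a4 a5 : K) :
    ((a3 = 0 → a1 ≠ 0) ∧ ∀ x y : K, y ^ 2 = x ^ 3 + A * x + B →
          a0 * x ^ 2 + a1 * x * y + a2 * x + a3 * y ^ 2 + a4 * y + a5 = 0 →
          TransAt A a0 a1 a2 a3 a4 x y) ↔
    (Saff A B a0 a1 a2 a3 a4 a5).encard + {p : Unit | a3 = 0}.encard = 6 := by
  rw [forall_trans_iff A B a0 a1 a2 a3 a4 a5, Saff_eq]
  have hf : (fP A B).natDegree = 3 := by unfold fP; compute_degree!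
  by_cases h3 : a3 = 0
  · have e1 : {p : Unit | a3 = 0}.encard = 1 := by simp [h3]
    rw [e1]
    by_cases h1 : a1 = 0
    · subst h1 h3
      simp only [ne_eq, not_true_eq_false, imp_false, false_and, false_iff]
      by_cases hN : uP A B a0 a2 0 a5 ^ 2 - fP A B * vP 0 a4 ^ 2 = 0
      · have h4 : a4 = 0 := by
          by_contra h4
          have h := congrArg Polynomial.natDegree (sub_eq_zero.mp hN)
          have hv : vP 0 a4 ^ 2 = Polynomial.C (a4 ^ 2) := by simp [vP]
          rw [Polynomial.natDegree_pow, hv, Polynomial.natDegree_mul_C (pow_ne_zero 2 h4), hf] at h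
          omega
        have hv : vP 0 a4 = 0 := by simp [vP, h4]
        have hu : uP A B a0 a2 0 a5 = 0 := by simpa [hv] using hN
        rw [hu, hv]
        have hinf : {p : Σ _ : K, K | p.2 ^ 2 = (fP A B).eval p.1 ∧
            (0 : Polynomial K).eval p.1 + (0 : Polynomial K).eval p.1 * p.2 = 0}.Infinite := by
          have hs : ∀ x : K, ∃ y : K, y ^ 2 = (fP A B).eval x := fun x =>
            IsAlgClosed.exists_pow_nat_eq _ (by norm_num)
          choose s hs using hs
          haveI : Infinite K := IsAlgClosed.instInfinite
          refine Set.infinite_of_injective_forall_mem (f := fun x : K => (⟨x, s x⟩ : Σ _ : K, K)) ?_ ?_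
          · intro x y h
            exact congrArg Sigma.fst h
          · intro x; simp [hs]
        rw [hinf.encard_eq]
        simp
      · obtain ⟨n, hn, hle, -⟩ := global_count h2 (fP A B) (uP A B a0 a2 0 a5) (vP 0 a4) hN
        have hd : (uP A B a0 a2 0 a5 ^ 2 - fP A B * vP 0 a4 ^ 2).natDegree ≤ 4 := by
          simp only [uP, fP, vP, Polynomial.C_0, zero_mul, zero_add]
          compute_degree
        rw [hn]
        intro h
        have : n + 1 = 6 := by exact_mod_cast h
        omega
    · have hd : (uP A B a0 a2 a3 a5 ^ 2 - fP A B * vP a1 a4 ^ 2).natDegree = 5 := by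
        simp only [uP, fP, vP, h3, Polynomial.C_0, zero_mul, zero_add]
        compute_degree!
      have hN : uP A B a0 a2 a3 a5 ^ 2 - fP A B * vP a1 a4 ^ 2 ≠ 0 := by
        intro h; rw [h] at hd; simp at hd
      obtain ⟨n, hn, hle, hiff⟩ := global_count h2 (fP A B) (uP A B a0 a2 a3 a5) (vP a1 a4) hN
      rw [hn, ← hiff, hd]
      have : ((n : ℕ∞) + 1 = 6) ↔ n + 1 = 6 := by norm_cast
      rw [this]
      simp [h1]
  · have e1 : {p : Unit | a3 = 0}.encard = 0 := by simp [h3]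
    have hd : (uP A B a0 a2 a3 a5 ^ 2 - fP A B * vP a1 a4 ^ 2).natDegree = 6 := by
      simp only [uP, fP, vP]
      compute_degree!
    have hN : uP A B a0 a2 a3 a5 ^ 2 - fP A B * vP a1 a4 ^ 2 ≠ 0 := by
      intro h; rw [h] at hd; simp at hd
    obtain ⟨n, hn, hle, hiff⟩ := global_count h2 (fP A B) (uP A B a0 a2 a3 a5) (vP a1 a4) hN
    rw [hn, ← hiff, hd, e1]
    have : ((n : ℕ∞) + 0 = 6) ↔ n = 6 := by rw [add_zero]; norm_cast
    rw [this]
    simp [h3]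

theorem proj_count (A B a0 a1 a2 a3 a4 a5 : K) :
    {p : Projectivization K (Fin 3 → K) |
            eval p.rep (Pcubic3 K A B) = 0 ∧
            eval p.rep (qForm3 K a0 a1 a2 a3 a4 a5) = 0}.encard =
    (Saff A B a0 a1 a2 a3 a4 a5).encard + {p : Unit | a3 = 0}.encard := by
  have hmk : ∀ (v : Fin 3 → K) (hv : v ≠ 0), (eval (Projectivization.mk K v hv).rep (Pcubic3 K A B) = 0 ∧
            eval (Projectivization.mk K v hv).rep (qForm3 K a0 a1 a2 a3 a4 a5) = 0) ↔
      (v 1 ^ 2 * v 2 - (v 0 ^ 3 + A * v 0 * v 2 ^ 2 + B * v 2 ^ 3) = 0 ∧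
        a0 * v 0 ^ 2 + a1 * v 0 * v 1 + a2 * v 0 * v 2 +
        a3 * v 1 ^ 2 + a4 * v 1 * v 2 + a5 * v 2 ^ 2 = 0) := by
    intro v hv
    obtain ⟨a, ha⟩ := Projectivization.exists_smul_eq_mk_rep K v hv
    rw [← ha, evP3, evq3]
    simp only [Pi.smul_apply, Units.smul_def, smul_eq_mul]
    have ha0 : (a : K) ≠ 0 := a.ne_zero
    constructor
    · rintro ⟨h, h'⟩
      constructor
      · apply mul_left_cancel₀ (pow_ne_zero 3 ha0)
        linear_combination h
      · apply mul_left_cancel₀ (pow_ne_zero 2 ha0)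
        linear_combination h'
    · rintro ⟨h, h'⟩
      constructor
      · linear_combination (a : K) ^ 3 * h
      · linear_combination (a : K) ^ 2 * h'
  have n1 : ∀ x y : K, (![x, y, 1] : Fin 3 → K) ≠ 0 := fun x y h => by simpa using congrFun h 2
  have n2 : (![0, 1, 0] : Fin 3 → K) ≠ 0 := fun h => by simpa using congrFun h 1
  let φ : (Σ _ : K, K) → Projectivization K (Fin 3 → K) :=
    fun p => Projectivization.mk K ![p.1, p.2, 1] (n1 _ _)
  let ψ : Unit → Projectivization K (Fin 3 → K) := fun _ => Projectivization.mk K ![0, 1, 0] n2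
  have hφ : Function.Injective φ := by
    rintro ⟨x, y⟩ ⟨x', y'⟩ h
    obtain ⟨a, ha⟩ := (Projectivization.mk_eq_mk_iff' K _ _ _ _).mp h
    have e0 := congrFun ha 0
    have e1 := congrFun ha 1
    have e2 := congrFun ha 2
    simp at e0 e1 e2
    subst e2
    simp at e0 e1
    rw [e0, e1]
  have hψ : Function.Injective ψ := fun _ _ _ => rfl
  have hset : {p : Projectivization K (Fin 3 → K) |
            eval p.rep (Pcubic3 K A B) = 0 ∧
            eval p.rep (qForm3 K a0 a1 a2 a3 a4 a5) = 0} =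
      φ '' Saff A B a0 a1 a2 a3 a4 a5 ∪ ψ '' {p : Unit | a3 = 0} := by
    ext p
    constructor
    · induction p using Projectivization.ind with
      | h v hv =>
      intro hp
      obtain ⟨hP, hq⟩ := (hmk v hv).mp hp
      by_cases hz : v 2 = 0
      · right
        simp [hz] at hP hq
        have hy : v 1 ≠ 0 := by
          intro hy
          apply hv
          ext i; fin_cases i <;> simp [*]
        simp [hP, hy] at hq
        refine ⟨(), hq, ?_⟩
        refine (Projectivization.mk_eq_mk_iff' K _ _ _ _).mpr ⟨(v 1)⁻¹, ?_⟩
        ext i; fin_cases i <;> simp [*]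
      · left
        obtain ⟨x, hx⟩ : ∃ x, v 0 = x * v 2 := ⟨v 0 / v 2, by field_simp⟩
        obtain ⟨y, hy⟩ : ∃ y, v 1 = y * v 2 := ⟨v 1 / v 2, by field_simp⟩
        rw [hx, hy] at hP hq
        refine ⟨⟨x, y⟩, ⟨?_, ?_⟩, ?_⟩
        · apply mul_left_cancel₀ (pow_ne_zero 3 hz)
          linear_combination hP
        · apply mul_left_cancel₀ (pow_ne_zero 2 hz)
          linear_combination hq
        · refine (Projectivization.mk_eq_mk_iff' K _ _ _ _).mpr ⟨(v 2)⁻¹, ?_⟩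
          ext i; fin_cases i <;> simp [hx, hy] <;> field_simp
    · rintro (⟨⟨x, y⟩, ⟨hP, hq⟩, rfl⟩ | ⟨_, h3, rfl⟩)
      · refine (hmk _ _).mpr ⟨?_, ?_⟩
        · simp at hP ⊢
          linear_combination hP
        · simp at hq ⊢
          linear_combination hq
      · have h3' : a3 = 0 := h3
        refine (hmk _ _).mpr ⟨?_, ?_⟩ <;> simp [h3']
  have hdisj : Disjoint (φ '' Saff A B a0 a1 a2 a3 a4 a5) (ψ '' {p : Unit | a3 = 0}) := by
    rw [Set.disjoint_left]
    rintro _ ⟨⟨x, y⟩, -, rfl⟩ ⟨_, -, h⟩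
    obtain ⟨a, ha⟩ := (Projectivization.mk_eq_mk_iff' K _ _ _ _).mp h
    have e1 := congrFun ha 1
    have e2 := congrFun ha 2
    have e0 := congrFun ha 0
    simp at e0 e1 e2
    simp [e2] at e1
  rw [hset, Set.encard_union_eq hdisj, hφ.encard_image, hψ.encard_image]

end helpers

/-- `C = V(P,Q) ⊂ ℙ³` is nonsingular iff `4A³ + 27B² ≠ 0` and the common
projective zero locus of `P` and `q` in `ℙ²` has exactly six points. -/
theorem stmt1 {K : Type*} [Field K] [IsAlgClosed K]
    (hchar : ringChar K = 0 ∨ 5 ≤ ringChar K)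
    (A B a0 a1 a2 a3 a4 a5 : K) :
    (∀ v : Fin 4 → K, v ≠ 0 →
        eval v (Pcubic K A B) = 0 → eval v (Qquad K a0 a1 a2 a3 a4 a5) = 0 →
        ¬ (jacMat (Pcubic K A B) (Qquad K a0 a1 a2 a3 a4 a5) v).rank ≤ 1) ↔
      (4 * A ^ 3 + 27 * B ^ 2 ≠ 0 ∧
        {p : Projectivization K (Fin 3 → K) |
            eval p.rep (Pcubic3 K A B) = 0 ∧
            eval p.rep (qForm3 K a0 a1 a2 a3 a4 a5) = 0}.ncard = 6) := by
  have hne : ∀ n : ℕ, 0 < n → n < 5 → Nat.Prime n → (n : K) ≠ 0 := by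
    intro n h0 h5 hp h
    have hd := (ringChar.spec K n).mp h
    rcases hchar with hc | hc
    · rw [hc] at hd
      have := Nat.eq_zero_of_zero_dvd hd
      omega
    · have := Nat.le_of_dvd h0 hd
      omega
  have h2 : (2 : K) ≠ 0 := by exact_mod_cast hne 2 (by norm_num) (by norm_num) (by norm_num)
  have h3 : (3 : K) ≠ 0 := by exact_mod_cast hne 3 (by norm_num) (by norm_num) (by norm_num)
  rw [nonsing_iff h2 h3, aff_count h2 A B a0 a1 a2 a3 a4 a5, ← proj_count]
  refine and_congr_right fun _ => ?_
  rw [Set.ncard_def]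
  constructor
  · intro h; rw [h]; rfl
  · intro h
    rw [← ENat.coe_toNat (n := Set.encard _) (fun ht => by rw [ht] at h; simp at h), h]
    rfl

end
end

section
/- Let K be a field of characteristic 0 or p ≥ 5. In the polynomial ring K[x, y, A, B, a0, a1, a2, a3, a4, a5] (with A, B, a0, ..., a5 now indeterminates), let J be the ideal generated by the three polynomials y² − (x³ + A·x + B), a0·x² + a1·x·y + a2·x + a3·y² + a4·y + a5, and a1·x + a4. Then the elimination ideal J ∩ K[A, B, a0, a1, a2, a3, a4, a5] is the principal ideal generated by f3 := A·a1²·a3·a4 − B·a1³·a3 − a0·a1·a4² − a1³·a5 + a1²·a2·a4 + a3·a4³. -/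
open MvPolynomial

noncomputable section

/-- Embedding of the eight parameter variables `A, B, a0, …, a5` into the ten variables
`x, y, A, B, a0, …, a5` (with `x = 0`, `y = 1`, `A = 2`, `B = 3`, `aᵢ = i + 4`). -/
def paramEmb : Fin 8 → Fin 10 := fun i => ⟨i.val + 2, by omega⟩

/-- `P̃ = y² − (x³ + A·x + B)` in `K[x, y, A, B, a0, …, a5]`. -/
def Ptil (K : Type*) [Field K] : MvPolynomial (Fin 10) K :=
  X 1 ^ 2 - (X 0 ^ 3 + X 2 * X 0 + X 3)

/-- `q̃ = a0·x² + a1·x·y + a2·x + a3·y² + a4·y + a5` in `K[x, y, A, B, a0, …, a5]`. -/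
def qtil (K : Type*) [Field K] : MvPolynomial (Fin 10) K :=
  X 4 * X 0 ^ 2 + X 5 * X 0 * X 1 + X 6 * X 0 + X 7 * X 1 ^ 2 + X 8 * X 1 + X 9

/-- `a1·x + a4` in `K[x, y, A, B, a0, …, a5]`. -/
def linxa (K : Type*) [Field K] : MvPolynomial (Fin 10) K :=
  X 5 * X 0 + X 8

/-- `f3 = A·a1²·a3·a4 − B·a1³·a3 − a0·a1·a4² − a1³·a5 + a1²·a2·a4 + a3·a4³` in
`K[A, B, a0, …, a5]` (variables `A = 0`, `B = 1`, `aᵢ = i + 2`). -/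
def f3poly (K : Type*) [Field K] : MvPolynomial (Fin 8) K :=
  X 0 * X 3 ^ 2 * X 5 * X 6 - X 1 * X 3 ^ 3 * X 5 - X 2 * X 3 * X 6 ^ 2
    - X 3 ^ 3 * X 7 + X 3 ^ 2 * X 4 * X 6 + X 5 * X 6 ^ 3

theorem f3_pseudo (K : Type*) [Field K] (h : MvPolynomial (Fin 8) K) :
    ∃ (N : ℕ) (r : MvPolynomial (Fin 8) K), f3poly K ∣ X 3 ^ N * h -
      aeval (fun i : Fin 8 => if i = 7 then (0 : MvPolynomial (Fin 8) K) else X i) r := by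
  induction h using MvPolynomial.induction_on with
  | C a => exact ⟨0, C a, by simp [← algebraMap_eq]⟩
  | add p q hp hq =>
    obtain ⟨N, r, u, hu⟩ := hp
    obtain ⟨M, s, v, hv⟩ := hq
    refine ⟨N + M, X 3 ^ M * r + X 3 ^ N * s, X 3 ^ M * u + X 3 ^ N * v, ?_⟩
    have h3 : ¬ ((3 : Fin 8) = 7) := by decide
    simp only [map_add, map_mul, map_pow, aeval_X, h3, if_false]
    linear_combination X 3 ^ M * hu + X 3 ^ N * hv
  | mul_X p i hp =>
    obtain ⟨N, r, u, hu⟩ := hp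
    by_cases hi : i = 7
    · subst hi
      have e : ∃ w : MvPolynomial (Fin 8) K, f3poly K = aeval (fun i : Fin 8 =>
          if i = 7 then (0 : MvPolynomial (Fin 8) K) else X i) w - X 3 ^ 3 * X 7 := by
        refine ⟨f3poly K, ?_⟩
        have h0 : ¬ ((0 : Fin 8) = 7) := by decide
        have h1 : ¬ ((1 : Fin 8) = 7) := by decide
        have h2 : ¬ ((2 : Fin 8) = 7) := by decide
        have h3 : ¬ ((3 : Fin 8) = 7) := by decide
        have h4 : ¬ ((4 : Fin 8) = 7) := by decide
        have h5 : ¬ ((5 : Fin 8) = 7) := by decide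
        have h6 : ¬ ((6 : Fin 8) = 7) := by decide
        simp only [f3poly, map_add, map_sub, map_mul, map_pow, aeval_X, h0, h1, h2, h3, h4, h5,
          h6, if_false, if_true]
        ring
      obtain ⟨w, hw⟩ := e
      refine ⟨N + 3, r * w, u * X 3 ^ 3 * X 7 -
        aeval (fun i : Fin 8 => if i = 7 then (0 : MvPolynomial (Fin 8) K) else X i) r, ?_⟩
      simp only [map_mul]
      linear_combination X 3 ^ 3 * X 7 * hu +
        aeval (fun i : Fin 8 => if i = 7 then (0 : MvPolynomial (Fin 8) K) else X i) r * hw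
    · refine ⟨N, r * X i, u * X i, ?_⟩
      simp only [map_mul, aeval_X, hi, if_false]
      linear_combination X i * hu

theorem f3_not_dvd (K : Type*) [Field K] : ¬ (X 3 : MvPolynomial (Fin 8) K) ∣ f3poly K := by
  rintro ⟨q, hq⟩
  have := congrArg (eval (fun i : Fin 8 => if i = 5 ∨ i = 6 then (1 : K) else 0)) hq
  simp [f3poly] at this

theorem f3_mem (K : Type*) [Field K] :
    rename paramEmb (f3poly K) ∈ Ideal.span {Ptil K, qtil K, linxa K} := by
  have hP : Ptil K ∈ Ideal.span {Ptil K, qtil K, linxa K} := Ideal.subset_span (by simp)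
  have hq : qtil K ∈ Ideal.span {Ptil K, qtil K, linxa K} := Ideal.subset_span (by simp)
  have hl : linxa K ∈ Ideal.span {Ptil K, qtil K, linxa K} := Ideal.subset_span (by simp)
  have e : rename paramEmb (f3poly K) =
      (X 7 * (X 5 ^ 2 * X 0 ^ 2 - X 5 * X 0 * X 8 + X 8 ^ 2) + X 4 * X 5 * (X 5 * X 0 - X 8)
        + (X 6 + X 2 * X 7) * X 5 ^ 2 + X 5 ^ 3 * X 1) * linxa K
      + (- X 5 ^ 3) * qtil K + (X 5 ^ 3 * X 7) * Ptil K := by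
    simp only [f3poly, map_add, map_sub, map_mul, map_pow, rename_X, Ptil, qtil, linxa]
    have h0 : paramEmb 0 = 2 := rfl
    have h1 : paramEmb 1 = 3 := rfl
    have h2 : paramEmb 2 = 4 := rfl
    have h3 : paramEmb 3 = 5 := rfl
    have h4 : paramEmb 4 = 6 := rfl
    have h5 : paramEmb 5 = 7 := rfl
    have h6 : paramEmb 6 = 8 := rfl
    have h7 : paramEmb 7 = 9 := rfl
    rw [h0, h1, h2, h3, h4, h5, h6, h7]
    ring
  rw [e]
  exact add_mem (add_mem (Ideal.mul_mem_left _ _ hl) (Ideal.mul_mem_left _ _ hq))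
    (Ideal.mul_mem_left _ _ hP)

/-- A generic point of the variety of `J` in an algebraically closed field, at which all
parameters other than `a5` are the generic ones. -/
theorem exists_point.{u} (K : Type u) [Field K] :
    ∃ (L : Type u) (_ : Field L) (_ : Algebra K L) (ι : MvPolynomial (Fin 8) K →ₐ[K] L)
      (Φ : MvPolynomial (Fin 10) K →ₐ[K] L), Function.Injective ι ∧
      Φ (Ptil K) = 0 ∧ Φ (qtil K) = 0 ∧ Φ (linxa K) = 0 ∧
      ∀ i : Fin 8, i ≠ 7 → Φ (X (paramEmb i)) = ι (X i) := by
  let R := MvPolynomial (Fin 8) K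
  let L := AlgebraicClosure (FractionRing R)
  let ι : R →ₐ[K] L := (IsScalarTower.toAlgHom K (FractionRing R) L).comp
    (IsScalarTower.toAlgHom K R (FractionRing R))
  have hι : Function.Injective ι :=
    (algebraMap (FractionRing R) L).injective.comp (IsFractionRing.injective R (FractionRing R))
  have h3 : ι (X 3) ≠ 0 := by
    rw [Ne, map_eq_zero_iff ι hι]
    exact X_ne_zero _
  let x : L := - ι (X 6) / ι (X 3)
  obtain ⟨y, hy⟩ := IsAlgClosed.exists_pow_nat_eq (x ^ 3 + ι (X 0) * x + ι (X 1))
    (n := 2) (by norm_num)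
  have hx : ι (X 3) * x + ι (X 6) = 0 := by
    rw [show x = - ι (X 6) / ι (X 3) from rfl, mul_div_cancel₀ _ h3, neg_add_cancel]
  refine ⟨L, inferInstance, inferInstance, ι,
    aeval ![x, y, ι (X 0), ι (X 1), ι (X 2), ι (X 3), ι (X 4), ι (X 5), ι (X 6),
      -(ι (X 2) * x ^ 2 + ι (X 4) * x + ι (X 5) * y ^ 2)], hι, ?_, ?_, ?_, ?_⟩
  · simp only [Ptil, map_add, map_sub, map_mul, map_pow, aeval_X]
    change y ^ 2 - (x ^ 3 + ι (X 0) * x + ι (X 1)) = 0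
    rw [hy, sub_self]
  · simp only [qtil, map_add, map_sub, map_mul, map_pow, aeval_X]
    change ι (X 2) * x ^ 2 + ι (X 3) * x * y + ι (X 4) * x + ι (X 5) * y ^ 2 + ι (X 6) * y +
      -(ι (X 2) * x ^ 2 + ι (X 4) * x + ι (X 5) * y ^ 2) = 0
    linear_combination y * hx
  · simp only [linxa, map_add, map_mul, aeval_X]
    exact hx
  · intro i hi
    rw [aeval_X]
    fin_cases i <;> first | rfl | exact absurd rfl hi

/-- the elimination ideal
`(y² − (x³+Ax+B), a0x²+a1xy+a2x+a3y²+a4y+a5, a1x+a4) ∩ K[A,B,a0,…,a5]`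
is the principal ideal generated by `f3`. -/
theorem stmt4 {K : Type*} [Field K] (hchar : ringChar K = 0 ∨ 5 ≤ ringChar K) :
    Ideal.comap (rename paramEmb : MvPolynomial (Fin 8) K →ₐ[K] MvPolynomial (Fin 10) K)
        (Ideal.span {Ptil K, qtil K, linxa K}) =
      Ideal.span {f3poly K} := by
  apply le_antisymm
  · intro h hh
    rw [Ideal.mem_comap] at hh
    obtain ⟨L, _, _, ι, Φ, hι, hP, hq, hl, hX⟩ := exists_point K
    have hJ : Ideal.span {Ptil K, qtil K, linxa K} ≤ RingHom.ker Φ := by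
      rw [Ideal.span_le]
      rintro p (rfl | rfl | rfl) <;> assumption
    have hh0 : Φ (rename paramEmb h) = 0 := hJ hh
    have hf0 : Φ (rename paramEmb (f3poly K)) = 0 := hJ (f3_mem K)
    obtain ⟨N, r, u, hu⟩ := f3_pseudo K h
    have key : (Φ.comp (rename paramEmb)).comp
        (aeval (fun i : Fin 8 => if i = 7 then (0 : MvPolynomial (Fin 8) K) else X i)) =
        ι.comp (aeval (fun i : Fin 8 => if i = 7 then (0 : MvPolynomial (Fin 8) K) else X i)) := by
      apply MvPolynomial.algHom_ext
      intro i
      simp only [AlgHom.comp_apply, aeval_X]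
      by_cases hi : i = 7
      · simp [hi]
      · simp only [hi, if_false, rename_X]
        exact hX i hi
    have hr : aeval (fun i : Fin 8 => if i = 7 then (0 : MvPolynomial (Fin 8) K) else X i) r
        = 0 := by
      apply hι
      have h1 := DFunLike.congr_fun key r
      simp only [AlgHom.comp_apply] at h1
      rw [← h1, map_zero]
      have h2 := congrArg (fun p => Φ (rename paramEmb p)) hu
      simp only [map_sub, map_mul, hh0, hf0, mul_zero, zero_mul, zero_sub, neg_eq_zero] at h2
      exact h2
    rw [hr, sub_zero] at hu
    have hp : Prime (X 3 : MvPolynomial (Fin 8) K) := MvPolynomial.X_prime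
    obtain ⟨v, rfl⟩ := hp.pow_dvd_of_dvd_mul_left N (f3_not_dvd K) (Dvd.intro _ hu)
    rw [Ideal.mem_span_singleton]
    refine ⟨v, mul_left_cancel₀ (pow_ne_zero N hp.ne_zero) ?_⟩
    rw [hu]
    ring
  · rw [Ideal.span_le, Set.singleton_subset_iff]
    exact f3_mem K

end
end

section
/- Let K be a field of characteristic 0 or p ≥ 5. In K[x, y, A, B, a0, a1, a2, a3, a4, a5], set P̃ := y² − (x³ + A·x + B), q̃ := a0·x² + a1·x·y + a2·x + a3·y² + a4·y + a5, and let J(P,q) := (∂P̃/∂x)·(∂q̃/∂y) − (∂P̃/∂y)·(∂q̃/∂x). Then the elimination ideal I := (P̃, q̃, J(P,q)) ∩ K[A, B, a0, a1, a2, a3, a4, a5] is a principal ideal, and it is generated by an irreducible polynomial f2 ∈ K[A, B, a0, ..., a5]. -/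
open MvPolynomial

noncomputable section

/-- The Jacobian determinant `J(P,q) = P̃ₓ·q̃_y − P̃_y·q̃ₓ`. -/
def Jpq (K : Type*) [Field K] : MvPolynomial (Fin 10) K :=
  pderiv 0 (Ptil K) * pderiv 1 (qtil K) - pderiv 1 (Ptil K) * pderiv 0 (qtil K)


/-- A kernel of trdeg-one-less is principal, generated by an irreducible. -/
theorem ker_principal {K : Type*} [Field K] {R : Type*} [CommRing R] [IsDomain R] [Algebra K R]
    (φ : MvPolynomial (Fin 8) K →ₐ[K] R)
    (hnot : ¬ AlgebraicIndependent K (fun i : Fin 8 => φ (X i)))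
    (hind : AlgebraicIndependent K (fun i : Fin 7 => φ (X i.castSucc))) :
    ∃ f : MvPolynomial (Fin 8) K, Irreducible f ∧ RingHom.ker φ = Ideal.span {f} := by
  have hprime : (RingHom.ker φ).IsPrime := RingHom.ker_isPrime _
  have hne : RingHom.ker φ ≠ ⊥ := by
    intro h
    apply hnot
    have hinj : Function.Injective φ := (RingHom.injective_iff_ker_eq_bot φ).2 h
    exact (algebraicIndependent_X (Fin 8) K).map' hinj
  obtain ⟨f, hf, hfp⟩ := hprime.exists_mem_prime_of_ne_bot hne
  refine ⟨f, hfp.irreducible, le_antisymm ?_ ((Ideal.span_singleton_le_iff_mem _).2 hf)⟩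
  have hfprime : (Ideal.span {f}).IsPrime := (Ideal.span_singleton_prime hfp.ne_zero).2 hfp
  let Q := MvPolynomial (Fin 8) K ⧸ Ideal.span {f}
  let π : MvPolynomial (Fin 8) K →ₐ[K] Q := Ideal.Quotient.mkₐ K (Ideal.span {f})
  have hπ : Function.Surjective π := Ideal.Quotient.mkₐ_surjective K _
  let ψ : Q →ₐ[K] R := Ideal.Quotient.liftₐ (Ideal.span {f}) φ (by
    intro a ha
    exact (Ideal.span_singleton_le_iff_mem (RingHom.ker φ)).2 hf ha)
  have hψπ : ∀ a, ψ (π a) = φ a := fun a => rfl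
  let w : Fin 7 → Q := fun i => π (X i.castSucc)
  have hw : AlgebraicIndependent K w := AlgebraicIndependent.of_comp ψ hind
  have htr : Algebra.trdeg K Q ≤ 7 := by
    by_contra hcon
    have h8 : (8 : Cardinal) ≤ Algebra.trdeg K Q := by
      have := Order.succ_le_of_lt (not_le.1 hcon)
      have e : Order.succ (7 : Cardinal) = 8 := by
        have := Cardinal.succ_natCast 7
        norm_num at this
        simpa using this
      rwa [e] at this
    let z : Fin 8 → Q := fun i => π (X i)
    have hadj : Algebra.adjoin K (Set.range z) = ⊤ := by
      have : Set.range z = π '' Set.range X := by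
        rw [← Set.range_comp]; rfl
      rw [this, ← AlgHom.map_adjoin, MvPolynomial.adjoin_range_X, Algebra.map_top]
      exact (AlgHom.range_eq_top π).2 hπ
    have halg : Algebra.IsAlgebraic (Algebra.adjoin K (Set.range z)) Q := by
      constructor
      intro a
      have ha : a ∈ Algebra.adjoin K (Set.range z) := by rw [hadj]; trivial
      exact isAlgebraic_algebraMap (⟨a, ha⟩ : Algebra.adjoin K (Set.range z))
    have hb : IsTranscendenceBasis K z :=
      Algebra.IsAlgebraic.isTranscendenceBasis_of_lift_le_trdeg_of_finite K z (by simpa using h8)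
    have hz : aeval z f = 0 := by
      have : aeval z f = π f := by
        have : aeval z = π := by ext i; simp [z]
        rw [this]
      rw [this]
      exact Ideal.Quotient.eq_zero_iff_mem.2 (Ideal.mem_span_singleton_self f)
    exact hfp.ne_zero ((algebraicIndependent_iff.1 hb.1) f hz)
  have hwb : IsTranscendenceBasis K w :=
    AlgebraicIndependent.isTranscendenceBasis_of_lift_trdeg_le_of_finite hw (by simpa using htr)
  have halg := hwb.isAlgebraic
  intro g hg
  by_contra hgf
  have h0 : π g ≠ 0 := fun h => hgf (Ideal.Quotient.eq_zero_iff_mem.1 h)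
  have hmem : π g ∈ RingHom.ker ψ := by
    rw [RingHom.mem_ker, hψπ]; exact hg
  have := Ideal.comap_ne_bot_of_algebraic_mem h0 hmem (halg.isAlgebraic (π g))
  apply this
  rw [eq_bot_iff]
  rintro ⟨a, ha⟩ hamem
  have hψa : ψ a = 0 := hamem
  rw [Algebra.adjoin_range_eq_range_aeval] at ha
  obtain ⟨p, hp⟩ := ha
  have hp' : aeval w p = a := hp
  have : aeval (fun i : Fin 7 => φ (X i.castSucc)) p = 0 := by
    rw [← hψa, ← hp', ← AlgHom.comp_apply, comp_aeval]
    rfl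
  have hp0 := (algebraicIndependent_iff.1 hind) p this
  have h0a : a = 0 := by rw [← hp', hp0, map_zero]
  exact Subtype.ext h0a

theorem Jpq_eq (K : Type*) [Field K] : Jpq K =
    (-(3 * X 0 ^ 2 + X 2)) * X 8 + (-(3 * X 0 ^ 2 + X 2) * (X 5 * X 0 + 2 * X 7 * X 1)
      - 2 * X 1 * (2 * X 4 * X 0 + X 5 * X 1 + X 6)) := by
  simp [Jpq, Ptil, qtil, pderiv_X]
  ring

theorem notMem_vars_of_supported {K : Type*} [Field K] {p : MvPolynomial (Fin 10) K} {i : Fin 10}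
    (h : p ∈ supported K ({i}ᶜ : Set (Fin 10))) : i ∉ p.vars := by
  intro hi
  exact (mem_supported.1 h hi) rfl

theorem X_supp {K : Type*} [Field K] {i j : Fin 10} (h : j ≠ i) :
    (X j : MvPolynomial (Fin 10) K) ∈ supported K ({i}ᶜ : Set (Fin 10)) :=
  X_mem_supported.2 h

theorem d_supp (K : Type*) [Field K] :
    (-(3 * X 0 ^ 2 + X 2) : MvPolynomial (Fin 10) K) ∈ supported K ({8}ᶜ : Set (Fin 10)) := by
  refine neg_mem (add_mem (mul_mem (ofNat_mem _ 3) (pow_mem (X_supp (by decide)) 2)) (X_supp (by decide)))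

theorem g_supp (K : Type*) [Field K] :
    (-(3 * X 0 ^ 2 + X 2) * (X 5 * X 0 + 2 * X 7 * X 1)
      - 2 * X 1 * (2 * X 4 * X 0 + X 5 * X 1 + X 6) : MvPolynomial (Fin 10) K)
      ∈ supported K ({8}ᶜ : Set (Fin 10)) := by
  have hX : ∀ j : Fin 10, j ≠ 8 → (X j : MvPolynomial (Fin 10) K) ∈
    supported K ({8}ᶜ : Set (Fin 10)) := fun j hj => X_supp hj
  have h2 : (2 : MvPolynomial (Fin 10) K) ∈ supported K ({8}ᶜ : Set (Fin 10)) := ofNat_mem _ 2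
  refine sub_mem (mul_mem (d_supp K) (add_mem (mul_mem ?_ ?_) (mul_mem (mul_mem h2 ?_) ?_)))
    (mul_mem (mul_mem h2 ?_) (add_mem (add_mem (mul_mem (mul_mem h2 ?_) ?_) (mul_mem ?_ ?_)) ?_))
  all_goals exact hX _ (by decide)

theorem d_irred (K : Type*) [Field K] :
    Irreducible (3 * X 0 ^ 2 + X 2 : MvPolynomial (Fin 10) K) := by
  have := irreducible_mul_X_add (1 : MvPolynomial (Fin 10) K) (3 * X 0 ^ 2) 2 one_ne_zero
    (by simp) (notMem_vars_of_supported
      (mul_mem (ofNat_mem _ 3) (pow_mem (X_supp (by decide)) 2))) isRelPrime_one_left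
  rwa [one_mul, add_comm] at this

theorem J_irred (K : Type*) [Field K] (h2 : (2 : K) ≠ 0) : Irreducible (Jpq K) := by
  rw [Jpq_eq]
  have hd := d_irred K
  refine irreducible_mul_X_add _ _ _ (neg_ne_zero.2 hd.ne_zero)
    (notMem_vars_of_supported (d_supp K)) (notMem_vars_of_supported (g_supp K)) ?_
  rw [IsRelPrime.neg_left_iff, hd.isRelPrime_iff_not_dvd]
  rintro ⟨c, hc⟩
  have := congrArg (eval (fun i : Fin 10 => if i = 1 ∨ i = 6 then (1 : K) else 0)) hc
  simp at this
  exact h2 this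

theorem degreeOf_of_supp {K : Type*} [Field K] {p : MvPolynomial (Fin 10) K} {i : Fin 10}
    (h : p ∈ supported K ({i}ᶜ : Set (Fin 10))) : degreeOf i p = 0 := by
  by_contra hne
  exact notMem_vars_of_supported h (mem_vars_iff_degreeOf_ne_zero.2 hne)

theorem J_degree (K : Type*) [Field K] : degreeOf 8 (Jpq K) ≠ 0 := by
  intro h
  have hJ : Jpq K ∈ supported K ({8}ᶜ : Set (Fin 10)) := by
    rw [mem_supported]
    intro j hj hj8
    have hj8 : j = 8 := hj8
    subst hj8
    exact mem_vars_iff_degreeOf_ne_zero.1 hj h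
  have hm := sub_mem hJ (g_supp K)
  rw [Jpq_eq, add_sub_cancel_right] at hm
  have := degreeOf_of_supp hm
  rw [degreeOf_mul_eq (neg_ne_zero.2 (d_irred K).ne_zero) (X_ne_zero _), degreeOf_X] at this
  simp at this

/-- the substitution eliminating `B` and `a5`. -/
def sig (K : Type*) [Field K] : MvPolynomial (Fin 10) K →ₐ[K] MvPolynomial (Fin 10) K :=
  aeval (fun i : Fin 10 => if i = 3 then X 1 ^ 2 - X 0 ^ 3 - X 2 * X 0
    else if i = 9 then
      -(X 4 * X 0 ^ 2 + X 5 * X 0 * X 1 + X 6 * X 0 + X 7 * X 1 ^ 2 + X 8 * X 1) else X i)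

theorem sig_X (K : Type*) [Field K] (i : Fin 10) (h3 : i ≠ 3) (h9 : i ≠ 9) :
    sig K (X i) = X i := by
  simp [sig, h3, h9]

def pp (K : Type*) [Field K] : Ideal (MvPolynomial (Fin 10) K) :=
  Ideal.span {Ptil K, qtil K, Jpq K}

theorem P_mem (K : Type*) [Field K] : Ptil K ∈ pp K := Ideal.subset_span (by simp)
theorem q_mem (K : Type*) [Field K] : qtil K ∈ pp K := Ideal.subset_span (by simp)
theorem J_mem (K : Type*) [Field K] : Jpq K ∈ pp K := Ideal.subset_span (by simp)

theorem sig_sub_mem (K : Type*) [Field K] (g : MvPolynomial (Fin 10) K) : g - sig K g ∈ pp K := by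
  have : (Ideal.Quotient.mkₐ K (pp K)).comp (sig K) = Ideal.Quotient.mkₐ K (pp K) := by
    ext i
    rw [AlgHom.comp_apply]
    by_cases h3 : i = 3
    · subst h3
      refine Ideal.Quotient.eq.2 ?_
      have : sig K (X 3) - X 3 = Ptil K := by
        simp [sig, Ptil]; ring
      rw [this]; exact P_mem K
    by_cases h9 : i = 9
    · subst h9
      refine Ideal.Quotient.eq.2 ?_
      have : sig K (X 9) - X 9 = - qtil K := by
        simp [sig, qtil]; ring
      rw [this]; exact neg_mem (q_mem K)
    rw [sig_X K i h3 h9]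
  exact Ideal.Quotient.eq.1 (DFunLike.congr_fun this g).symm

theorem pp_eq (K : Type*) [Field K] : pp K = (Ideal.span {Jpq K}).comap (sig K) := by
  apply le_antisymm
  · rw [pp, Ideal.span_le]
    rintro g (rfl | rfl | rfl)
    · have : sig K (Ptil K) = 0 := by simp [sig, Ptil]
      simp [this]
    · have : sig K (qtil K) = 0 := by simp [sig, qtil]
      simp [this]
    · have : sig K (Jpq K) = Jpq K := by simp [sig, Jpq_eq, map_ofNat]
      simp only [SetLike.mem_coe, Ideal.mem_comap, this]
      exact Ideal.mem_span_singleton_self _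
  · intro g hg
    have h1 : sig K g ∈ pp K :=
      (Ideal.span_singleton_le_iff_mem (pp K)).2 (J_mem K) hg
    have := add_mem (sig_sub_mem K g) h1
    rwa [sub_add_cancel] at this

theorem pp_prime (K : Type*) [Field K] (h2 : (2 : K) ≠ 0) : (pp K).IsPrime := by
  rw [pp_eq]
  have : (Ideal.span {Jpq K}).IsPrime :=
    (Ideal.span_singleton_prime (J_irred K h2).ne_zero).2 (J_irred K h2).prime
  exact Ideal.comap_isPrime _ _

def ind7 : Fin 7 → Fin 10 := ![0, 1, 2, 4, 5, 6, 7]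

theorem ind7_ne (i : Fin 7) : ind7 i ≠ 3 ∧ ind7 i ≠ 9 ∧ ind7 i ≠ 8 := by
  revert i; decide

theorem low_indep (K : Type*) [Field K] :
    AlgebraicIndependent K
      (fun i : Fin 7 => Ideal.Quotient.mkₐ K (pp K) (X (ind7 i))) := by
  rw [algebraicIndependent_iff]
  intro p hp
  have e1 : aeval (fun i : Fin 7 => Ideal.Quotient.mkₐ K (pp K) (X (ind7 i))) p =
      Ideal.Quotient.mkₐ K (pp K) (rename ind7 p) := by
    have : aeval (fun i : Fin 7 => Ideal.Quotient.mkₐ K (pp K) (X (ind7 i))) =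
      (Ideal.Quotient.mkₐ K (pp K)).comp (rename ind7) := by ext i; simp
    rw [this]; rfl
  rw [e1] at hp
  have hmem : rename ind7 p ∈ pp K := Ideal.Quotient.eq_zero_iff_mem.1 hp
  rw [pp_eq, Ideal.mem_comap] at hmem
  have e2 : sig K (rename ind7 p) = rename ind7 p := by
    have : (sig K).comp (rename ind7) = rename ind7 := by
      ext1 i
      rw [AlgHom.comp_apply, rename_X, sig_X K _ (ind7_ne i).1 (ind7_ne i).2.1]
    exact DFunLike.congr_fun this p
  rw [e2, Ideal.mem_span_singleton] at hmem
  obtain ⟨c, hc⟩ := hmem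
  have hinj : Function.Injective ind7 := by decide
  by_contra hp0
  have hr0 : rename ind7 p ≠ 0 := fun h =>
    hp0 ((rename_injective ind7 hinj) (by rw [h, map_zero]))
  have hs : rename ind7 p ∈ supported K ({8}ᶜ : Set (Fin 10)) := by
    rw [supported_eq_range_rename]
    have : rename ind7 p = rename (Subtype.val : ({8}ᶜ : Set (Fin 10)) → Fin 10)
        (rename (fun i => (⟨ind7 i, (ind7_ne i).2.2⟩ : ({8}ᶜ : Set (Fin 10)))) p) := by
      rw [rename_rename]; rfl
    rw [this]
    exact ⟨_, rfl⟩
  have hd := degreeOf_of_supp hs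
  rw [hc] at hr0 hd
  rw [degreeOf_mul_eq (left_ne_zero_of_mul hr0) (right_ne_zero_of_mul hr0)] at hd
  exact J_degree K (by omega)

theorem x_algebraic {S R : Type*} [CommRing S] [IsDomain S] [CommRing R] [Algebra S R]
    (A B a0 a1 a2 a3 a4 : S) (h6 : 6 * a3 ≠ 0) (x y : R)
    (hP : y ^ 2 = x ^ 3 + algebraMap S R A * x + algebraMap S R B)
    (hJ : -(3 * x ^ 2 + algebraMap S R A) *
        (algebraMap S R a1 * x + 2 * algebraMap S R a3 * y + algebraMap S R a4)
      - 2 * y * (2 * algebraMap S R a0 * x + algebraMap S R a1 * y + algebraMap S R a2) = 0) :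
    IsAlgebraic S x := by
  let f : Polynomial S := .X ^ 3 + .C A * .X + .C B
  let u : Polynomial S := (3 * .X ^ 2 + .C A) * (.C a1 * .X + .C a4) + 2 * .C a1 * f
  let w : Polynomial S := .C (6 * a3) * .X ^ 2 + .C (4 * a0) * .X + .C (2 * a2 + 2 * a3 * A)
  have hf : f.natDegree = 3 := by
    simp only [f]; compute_degree!
  have hf0 : f ≠ 0 := by
    intro h; rw [h] at hf; simp at hf
  have hw0 : w ≠ 0 := by
    intro h
    have : w.coeff 2 = 6 * a3 := by
      simp only [w]; compute_degree!
    rw [h] at this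
    exact h6 (by simpa using this.symm)
  refine ⟨u ^ 2 - f * w ^ 2, ?_, ?_⟩
  · intro h
    have h1 := congrArg Polynomial.natDegree (sub_eq_zero.1 h)
    rw [Polynomial.natDegree_pow, Polynomial.natDegree_mul hf0 (pow_ne_zero 2 hw0),
      Polynomial.natDegree_pow, hf] at h1
    omega
  · have hfx : Polynomial.aeval x f = y ^ 2 := by simp [f, hP]
    have hux : Polynomial.aeval x u = - y * Polynomial.aeval x w := by
      simp only [u, map_add, map_mul, hfx]
      simp [w, map_ofNat]
      linear_combination -hJ
    rw [map_sub, map_mul, map_pow, map_pow, hfx, hux]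
    ring

def vv (K : Type*) [Field K] (i : Fin 7) : MvPolynomial (Fin 10) K ⧸ pp K :=
  Ideal.Quotient.mkₐ K (pp K) (X (paramEmb i.castSucc))

theorem vv_alg (K : Type*) [Field K] (h2 : (2 : K) ≠ 0) (h3 : (3 : K) ≠ 0) :
    Algebra.IsAlgebraic (Algebra.adjoin K (Set.range (vv K)))
      (MvPolynomial (Fin 10) K ⧸ pp K) := by
  have := pp_prime K h2
  let π := Ideal.Quotient.mkₐ K (pp K)
  let S := Algebra.adjoin K (Set.range (vv K))
  have hmem : ∀ i : Fin 7, vv K i ∈ S := fun i => Algebra.subset_adjoin ⟨i, rfl⟩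
  let s : Fin 7 → S := fun i => ⟨vv K i, hmem i⟩
  have hPm : π (Ptil K) = 0 := Ideal.Quotient.eq_zero_iff_mem.2 (P_mem K)
  have hqm : π (qtil K) = 0 := Ideal.Quotient.eq_zero_iff_mem.2 (q_mem K)
  have hJm : π (Jpq K) = 0 := Ideal.Quotient.eq_zero_iff_mem.2 (J_mem K)
  have s0 : algebraMap S _ (s 0) = π (X 2) := rfl
  have s1 : algebraMap S _ (s 1) = π (X 3) := rfl
  have s2 : algebraMap S _ (s 2) = π (X 4) := rfl
  have s3 : algebraMap S _ (s 3) = π (X 5) := rfl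
  have s4 : algebraMap S _ (s 4) = π (X 6) := rfl
  have s5 : algebraMap S _ (s 5) = π (X 7) := rfl
  have s6 : algebraMap S _ (s 6) = π (X 8) := rfl
  have h6 : 6 * s 5 ≠ 0 := by
    intro h
    have h' := congrArg (algebraMap S (MvPolynomial (Fin 10) K ⧸ pp K)) h
    rw [map_mul, s5, map_zero] at h'
    rcases mul_eq_zero.1 h' with h' | h'
    · have e : algebraMap K (MvPolynomial (Fin 10) K ⧸ pp K) 6 = 0 := by
        rw [← h', map_ofNat, map_ofNat]
      have h60 : (6 : K) = 0 := by
        apply (algebraMap K (MvPolynomial (Fin 10) K ⧸ pp K)).injective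
        rw [e, map_zero]
      have : (6 : K) = 2 * 3 := by norm_num
      rw [this] at h60
      exact (mul_ne_zero h2 h3) h60
    · exact (low_indep K).ne_zero 6 h'
  have hx : IsAlgebraic S (π (X 0)) := by
    refine x_algebraic (s 0) (s 1) (s 2) (s 3) (s 4) (s 5) (s 6) h6 (π (X 0)) (π (X 1)) ?_ ?_
    · rw [s0, s1]
      simp only [Ptil, map_sub, map_add, map_mul, map_pow] at hPm
      linear_combination hPm
    · rw [s0, s2, s3, s4, s5, s6]
      simp only [Jpq_eq, map_sub, map_add, map_mul, map_pow, map_neg, map_ofNat] at hJm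
      linear_combination hJm
  have hs : ∀ i : Fin 7, IsAlgebraic S (vv K i) := fun i => isAlgebraic_algebraMap (s i)
  have hy : IsAlgebraic S (π (X 1)) := by
    have e : π (X 1) ^ 2 = π (X 0) ^ 3 + π (X 2) * π (X 0) + π (X 3) := by
      simp only [Ptil, map_sub, map_add, map_mul, map_pow] at hPm
      linear_combination hPm
    refine IsAlgebraic.of_pow (n := 2) (by norm_num) ?_
    rw [e]
    exact ((hx.pow 3).add ((hs 0).mul hx)).add (hs 1)
  have ha5 : IsAlgebraic S (π (X 9)) := by
    have e : π (X 9) = -(π (X 4) * π (X 0) ^ 2 + π (X 5) * π (X 0) * π (X 1) + π (X 6) * π (X 0)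
        + π (X 7) * π (X 1) ^ 2 + π (X 8) * π (X 1)) := by
      simp only [qtil, map_add, map_mul, map_pow] at hqm
      linear_combination hqm
    rw [e]
    exact ((((((hs 2).mul (hx.pow 2)).add (((hs 3).mul hx).mul hy)).add ((hs 4).mul hx)).add
      ((hs 5).mul (hy.pow 2))).add ((hs 6).mul hy)).neg
  have hX : ∀ i : Fin 10, IsAlgebraic S (π (X i)) := by
    intro i
    fin_cases i
    exacts [hx, hy, hs 0, hs 1, hs 2, hs 3, hs 4, hs 5, hs 6, ha5]
  constructor
  intro a
  obtain ⟨p, rfl⟩ := Ideal.Quotient.mkₐ_surjective K (pp K) a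
  change IsAlgebraic S (π p)
  induction p using MvPolynomial.induction_on with
  | C c =>
    have : π (C c) = algebraMap S _ (algebraMap K S c) := rfl
    rw [this]
    exact isAlgebraic_algebraMap _
  | add p q hp hq => rw [map_add]; exact hp.add hq
  | mul_X p i hp => rw [map_mul]; exact hp.mul (hX i)

/-- the elimination ideal
`(P̃, q̃, J(P,q)) ∩ K[A, B, a0, …, a5]` is principal, generated by an irreducible
polynomial `f2`. -/
theorem stmt5 {K : Type*} [Field K] (hchar : ringChar K = 0 ∨ 5 ≤ ringChar K) :
    ∃ f2 : MvPolynomial (Fin 8) K, Irreducible f2 ∧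
      Ideal.comap (rename paramEmb : MvPolynomial (Fin 8) K →ₐ[K] MvPolynomial (Fin 10) K)
          (Ideal.span {Ptil K, qtil K, Jpq K}) =
        Ideal.span {f2} := by
  have h2 : (2 : K) ≠ 0 := by
    intro h
    have : ringChar K ∣ 2 := (ringChar.spec K 2).1 (by exact_mod_cast h)
    have h1 := Nat.le_of_dvd (by norm_num) this
    rcases hchar with h0 | h0
    · rw [h0] at this; norm_num at this
    · omega
  have h3 : (3 : K) ≠ 0 := by
    intro h
    have : ringChar K ∣ 3 := (ringChar.spec K 3).1 (by exact_mod_cast h)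
    have h1 := Nat.le_of_dvd (by norm_num) this
    rcases hchar with h0 | h0
    · rw [h0] at this; norm_num at this
    · omega
  have := pp_prime K h2
  have halg := vv_alg K h2 h3
  have hlow : (7 : Cardinal) ≤ Algebra.trdeg K (MvPolynomial (Fin 10) K ⧸ pp K) := by
    have := (low_indep K).lift_cardinalMk_le_trdeg
    simpa using this
  have hb : IsTranscendenceBasis K (vv K) :=
    Algebra.IsAlgebraic.isTranscendenceBasis_of_lift_le_trdeg_of_finite K (vv K)
      (by simpa using hlow)
  have htr : Algebra.trdeg K (MvPolynomial (Fin 10) K ⧸ pp K) = 7 := by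
    have := hb.lift_cardinalMk_eq_trdeg
    simpa using this.symm
  let φ : MvPolynomial (Fin 8) K →ₐ[K] MvPolynomial (Fin 10) K ⧸ pp K :=
    (Ideal.Quotient.mkₐ K (pp K)).comp (rename paramEmb)
  obtain ⟨f, hf, hker⟩ := ker_principal φ (by
      intro h
      have := h.lift_cardinalMk_le_trdeg
      rw [htr] at this
      simp at this
      norm_num at this) (by
      have e : (fun i : Fin 7 => φ (X i.castSucc)) = vv K := by
        funext i
        simp [φ, vv]
      rw [e]
      exact hb.1)
  refine ⟨f, hf, ?_⟩
  rw [← hker]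
  ext g
  rw [Ideal.mem_comap, RingHom.mem_ker]
  exact Ideal.Quotient.eq_zero_iff_mem.symm
end
end

section
/- Let K be an algebraically closed field of characteristic p ≥ 5. In K[x, y, A, B, a0, ..., a5] set P̃ := y² − (x³ + A·x + B), q̃ := a0·x² + a1·x·y + a2·x + a3·y² + a4·y + a5, J(P,q) := (∂P̃/∂x)·(∂q̃/∂y) − (∂P̃/∂y)·(∂q̃/∂x), and let I := (P̃, q̃, J(P,q)) ∩ K[A, B, a0, ..., a5] be the elimination ideal. Then for any values (A, B, a0, a1, a2, a3, a4, a5) ∈ K⁸, the projective curve C = V(P,Q) ⊂ ℙ³(K) is nonsingular if and only if 4A³ + 27B² ≠ 0 and some element of I has nonzero value at (A, B, a0, ..., a5) (equivalently, the irreducible generator f2 of I satisfies f2(A, B, a0, ..., a5) ≠ 0). -/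
open MvPolynomial

noncomputable section

/-- The elimination ideal `I = (P̃, q̃, J(P,q)) ∩ K[A, B, a0, …, a5]`. -/
def elimIdeal (K : Type*) [Field K] : Ideal (MvPolynomial (Fin 8) K) :=
  Ideal.comap (rename paramEmb : MvPolynomial (Fin 8) K →ₐ[K] MvPolynomial (Fin 10) K)
    (Ideal.span {Ptil K, qtil K, Jpq K})


lemma s6_rank_iff {K : Type*} [Field K] (M : Matrix (Fin 2) (Fin 4) K) :
    M.rank ≤ 1 ↔ ∃ s t : K, (s ≠ 0 ∨ t ≠ 0) ∧ ∀ k, s * M 0 k + t * M 1 k = 0 := by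
  have h1 : M.rank ≤ 1 ↔ ¬ LinearIndependent K M.row := by
    constructor
    · intro h hl
      have := hl.rank_matrix
      simp at this
      omega
    · intro h
      by_contra hr
      apply h
      rw [linearIndependent_iff_card_eq_finrank_span, Set.finrank, ← Matrix.rank_eq_finrank_span_row]
      have := M.rank_le_card_height
      simp at this ⊢
      omega
  rw [h1, Fintype.linearIndependent_iff]
  push Not
  constructor
  · rintro ⟨c, hc, i, hi⟩
    refine ⟨c 0, c 1, ?_, ?_⟩
    · fin_cases i
      · left; exact hi
      · right; exact hi
    · intro k
      have := congrFun hc k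
      simpa [Fin.sum_univ_two, Matrix.row] using this
  · rintro ⟨s, t, hst, h⟩
    refine ⟨![s, t], ?_, ?_⟩
    · funext k
      simpa [Fin.sum_univ_two, Matrix.row] using h k
    · rcases hst with h | h
      · exact ⟨0, by simpa using h⟩
      · exact ⟨1, by simpa using h⟩

lemma s6_evalP {K : Type*} [Field K] (A B x y z w : K) :
    eval ![x, y, z, w] (Pcubic K A B) = y ^ 2 * z - (x ^ 3 + A * x * z ^ 2 + B * z ^ 3) := by
  simp [Pcubic]

lemma s6_evalQ {K : Type*} [Field K] (a0 a1 a2 a3 a4 a5 x y z w : K) :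
    eval ![x, y, z, w] (Qquad K a0 a1 a2 a3 a4 a5) = w ^ 2 - (a0 * x ^ 2 + a1 * x * y + a2 * x * z
      + a3 * y ^ 2 + a4 * y * z + a5 * z ^ 2) := by
  simp [Qquad, qForm]

/-- The rank condition, spelled out in coordinates. -/
lemma s6_sing {K : Type*} [Field K] (A B a0 a1 a2 a3 a4 a5 x y z w : K) :
    (jacMat (Pcubic K A B) (Qquad K a0 a1 a2 a3 a4 a5) ![x, y, z, w]).rank ≤ 1 ↔
    ∃ s t : K, (s ≠ 0 ∨ t ≠ 0) ∧
      s * (3 * x ^ 2 + A * z ^ 2) + t * (2 * a0 * x + a1 * y + a2 * z) = 0 ∧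
      s * (2 * y * z) - t * (a1 * x + 2 * a3 * y + a4 * z) = 0 ∧
      s * (y ^ 2 - 2 * A * x * z - 3 * B * z ^ 2) - t * (a2 * x + a4 * y + 2 * a5 * z) = 0 ∧
      t * (2 * w) = 0 := by
  rw [s6_rank_iff]
  refine exists_congr fun s => exists_congr fun t => and_congr_right fun _ => ?_
  have p01 : pderiv (R := K) (0 : Fin 4) (X 1) = 0 := pderiv_X_of_ne (by decide)
  have p02 : pderiv (R := K) (0 : Fin 4) (X 2) = 0 := pderiv_X_of_ne (by decide)
  have p03 : pderiv (R := K) (0 : Fin 4) (X 3) = 0 := pderiv_X_of_ne (by decide)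
  have p10 : pderiv (R := K) (1 : Fin 4) (X 0) = 0 := pderiv_X_of_ne (by decide)
  have p12 : pderiv (R := K) (1 : Fin 4) (X 2) = 0 := pderiv_X_of_ne (by decide)
  have p13 : pderiv (R := K) (1 : Fin 4) (X 3) = 0 := pderiv_X_of_ne (by decide)
  have p20 : pderiv (R := K) (2 : Fin 4) (X 0) = 0 := pderiv_X_of_ne (by decide)
  have p21 : pderiv (R := K) (2 : Fin 4) (X 1) = 0 := pderiv_X_of_ne (by decide)
  have p23 : pderiv (R := K) (2 : Fin 4) (X 3) = 0 := pderiv_X_of_ne (by decide)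
  have p30 : pderiv (R := K) (3 : Fin 4) (X 0) = 0 := pderiv_X_of_ne (by decide)
  have p31 : pderiv (R := K) (3 : Fin 4) (X 1) = 0 := pderiv_X_of_ne (by decide)
  have p32 : pderiv (R := K) (3 : Fin 4) (X 2) = 0 := pderiv_X_of_ne (by decide)
  simp only [Fin.forall_fin_succ, Fin.succ_zero_eq_one, Fin.succ_one_eq_two, jacMat,
    Matrix.of_apply, Pcubic, Qquad, qForm]
  have e3 : (Fin.succ 2 : Fin 4) = 3 := rfl
  simp [e3, Derivation.leibniz, Derivation.leibniz_pow, p01, p02, p03, p10, p12, p13, p20, p21, p23, p30, p31, p32]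
  refine and_congr ?_ (and_congr ?_ (and_congr ?_ ?_))
  · constructor <;> intro h <;> linear_combination -h
  · constructor <;> intro h <;> linear_combination h
  · constructor <;> intro h <;> linear_combination h
  · rfl

/-- Elements of the elimination ideal vanish at parameters with a tangency point, over any ring. -/
lemma s6_elim_vanish {K L : Type*} [Field K] [CommRing L] (k : K →+* L)
    (x y A B a0 a1 a2 a3 a4 a5 : L)
    (hP : y ^ 2 - (x ^ 3 + A * x + B) = 0)
    (hq : a0 * x ^ 2 + a1 * x * y + a2 * x + a3 * y ^ 2 + a4 * y + a5 = 0)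
    (hJ : (3 * x ^ 2 + A) * (a1 * x + 2 * a3 * y + a4) + 2 * y * (2 * a0 * x + a1 * y + a2) = 0)
    (g : MvPolynomial (Fin 8) K) (hg : g ∈ elimIdeal K) :
    eval₂ k ![A, B, a0, a1, a2, a3, a4, a5] g = 0 := by
  have h1 : Ideal.span {Ptil K, qtil K, Jpq K} ≤
      RingHom.ker (eval₂Hom k ![x, y, A, B, a0, a1, a2, a3, a4, a5]) := by
    rw [Ideal.span_le]
    rintro f (rfl | rfl | rfl)
    · simpa [RingHom.mem_ker, Ptil] using hP
    · simpa [RingHom.mem_ker, qtil] using hq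
    · have n01 : ∀ i : Fin 10, i ≠ 0 → pderiv (R := K) (0 : Fin 10) (X i) = 0 :=
        fun i hi => pderiv_X_of_ne hi
      have n10 : ∀ i : Fin 10, i ≠ 1 → pderiv (R := K) (1 : Fin 10) (X i) = 0 :=
        fun i hi => pderiv_X_of_ne hi
      simp [RingHom.mem_ker, Jpq, Ptil, qtil, Derivation.leibniz, Derivation.leibniz_pow,
        n01, n10]
      linear_combination -hJ
  have h2 := h1 (show rename paramEmb g ∈ _ from hg)
  rw [RingHom.mem_ker, coe_eval₂Hom, eval₂_rename] at h2
  convert h2 using 2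
  funext i
  fin_cases i <;> rfl

/-- A tangency at infinity is a limit of affine tangencies. -/
lemma s6_infinity {K : Type*} [Field K] (A B a0 a2 a4 a5 : K)
    (g : MvPolynomial (Fin 8) K) (hg : g ∈ elimIdeal K) :
    eval ![A, B, a0, 0, a2, 0, a4, a5] g = 0 := by
  let cc : K →+* PowerSeries K := PowerSeries.C
  obtain ⟨t, ht⟩ : ∃ t : PowerSeries K, t = PowerSeries.X := ⟨_, rfl⟩
  have ht0 : t ≠ 0 := ht ▸ PowerSeries.X_ne_zero
  have htc : PowerSeries.constantCoeff t = 0 := by simp [ht]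
  obtain ⟨r, hr⟩ : ∃ r, r = 1 + cc A * t ^ 4 + cc B * t ^ 6 := ⟨_, rfl⟩
  have hrc : PowerSeries.constantCoeff r = 1 := by simp [hr, htc]
  obtain ⟨ri, hri⟩ : ∃ ri : PowerSeries K, r * ri = 1 :=
    ⟨r⁻¹, PowerSeries.mul_inv_cancel r (by simp [hrc])⟩
  have hric : PowerSeries.constantCoeff ri = 1 := by
    have := congrArg PowerSeries.constantCoeff hri
    simpa [hrc] using this
  obtain ⟨D, hD⟩ : ∃ D, D = 2 * r - 3 - cc A * t ^ 4 * r ^ 2 := ⟨_, rfl⟩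
  have hDc : PowerSeries.constantCoeff D = -1 := by
    simp only [hD, map_sub, map_mul, map_pow, htc, hrc, map_ofNat]; norm_num
  obtain ⟨Di, hDi⟩ : ∃ Di : PowerSeries K, D * Di = 1 :=
    ⟨D⁻¹, PowerSeries.mul_inv_cancel D (by simp [hDc])⟩
  obtain ⟨B', hB'⟩ : ∃ B', B' = (cc B - 2 * cc A ^ 2 * t ^ 2 - 2 * cc A * cc B * t ^ 4
    - cc A * t ^ 6 * (cc A + cc B * t ^ 2) ^ 2) * ri ^ 3 := ⟨_, rfl⟩
  obtain ⟨E, hE⟩ : ∃ E, E = 3 + cc A * t ^ 4 * r ^ 2 := ⟨_, rfl⟩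
  obtain ⟨c, hc⟩ : ∃ c, c = cc a0 + cc a2 * t ^ 2 * r + cc a4 * t * r + cc a5 * t ^ 4 * r ^ 2 :=
    ⟨_, rfl⟩
  obtain ⟨a1, ha1⟩ : ∃ a1, a1 = (2 * E * c * t - t ^ 2 * r * cc a4 * E
    - 2 * t * r * (2 * cc a0 + cc a2 * t ^ 2 * r)) * Di := ⟨_, rfl⟩
  obtain ⟨a3, ha3⟩ : ∃ a3, a3 = - t ^ 2 * c - t * a1 := ⟨_, rfl⟩
  have hB2 : r = 1 + cc A * t ^ 4 * r ^ 2 + B' * t ^ 6 * r ^ 3 := by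
    have : B' * r ^ 3 = (cc B - 2 * cc A ^ 2 * t ^ 2 - 2 * cc A * cc B * t ^ 4
        - cc A * t ^ 6 * (cc A + cc B * t ^ 2) ^ 2) := by
      have h3 : (r * ri) ^ 3 = 1 := by rw [hri, one_pow]
      rw [hB']
      linear_combination (cc B - 2 * cc A ^ 2 * t ^ 2 - 2 * cc A * cc B * t ^ 4
        - cc A * t ^ 6 * (cc A + cc B * t ^ 2) ^ 2) * h3
    have h4 : B' * t ^ 6 * r ^ 3 = t ^ 6 * (B' * r ^ 3) := by ring
    rw [h4, this, hr]
    ring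
  have ha1D : a1 * D = 2 * E * c * t - t ^ 2 * r * cc a4 * E
    - 2 * t * r * (2 * cc a0 + cc a2 * t ^ 2 * r) := by
    rw [ha1]
    linear_combination (2 * E * c * t - t ^ 2 * r * cc a4 * E
      - 2 * t * r * (2 * cc a0 + cc a2 * t ^ 2 * r)) * hDi
  obtain ⟨L, _, ι, hι⟩ : ∃ (L : Type _) (_ : Field L) (ι : PowerSeries K →+* L),
      Function.Injective ι :=
    ⟨FractionRing (PowerSeries K), inferInstance, algebraMap _ _, IsFractionRing.injective _ _⟩
  have hr0 : r ≠ 0 := by rintro rfl; simp at hrc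
  have htL : ι t ≠ 0 := fun h => ht0 (hι (by rw [h, map_zero]))
  have hrL : ι r ≠ 0 := fun h => hr0 (hι (by rw [h, map_zero]))
  have key := s6_elim_vanish (ι.comp cc) (1 / (ι t ^ 2 * ι r)) (1 / (ι t ^ 3 * ι r))
    (ι (cc A)) (ι B') (ι (cc a0)) (ι a1) (ι (cc a2)) (ι a3) (ι (cc a4)) (ι (cc a5))
    (by
      have := congrArg ι hB2
      simp only [map_add, map_mul, map_pow, map_one] at this
      field_simp
      linear_combination this)
    (by
      have h1 := congrArg ι ha3
      have h2 := congrArg ι hc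
      simp only [map_add, map_sub, map_neg, map_mul, map_pow, map_one] at h1 h2
      rw [h1, h2]
      field_simp
      ring)
    (by
      have h1 := congrArg ι ha3
      have h3 := congrArg ι hD
      have h4 := congrArg ι hE
      have h5 := congrArg ι ha1D
      simp only [map_add, map_sub, map_neg, map_mul, map_pow, map_one, map_ofNat] at h1 h3 h4 h5
      rw [h3] at h5
      rw [h4] at h5
      rw [h1]
      field_simp
      linear_combination h5) g hg
  have key2 : ι (eval₂ cc ![cc A, B', cc a0, a1, cc a2, a3, cc a4, cc a5] g) = 0 := by
    rw [← key, hom_eval₂]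
    congr 1
    funext i
    fin_cases i <;> rfl
  have key3 := congrArg PowerSeries.constantCoeff ((map_eq_zero_iff ι hι).1 key2)
  rw [hom_eval₂, map_zero] at key3
  have c0 : (PowerSeries.constantCoeff (R := K)).comp cc = RingHom.id K := by ext a; simp [cc]
  have c1 : PowerSeries.constantCoeff a1 = 0 := by simp [ha1, htc]
  have c3 : PowerSeries.constantCoeff a3 = 0 := by simp [ha3, htc]
  have cB : PowerSeries.constantCoeff B' = B := by simp [hB', htc, hric, cc]
  have cf : (fun i => PowerSeries.constantCoeff
      (![cc A, B', cc a0, a1, cc a2, a3, cc a4, cc a5] i)) = ![A, B, a0, 0, a2, 0, a4, a5] := by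
    funext i
    fin_cases i <;> simp [cc, c1, c3, cB]
  rw [c0, cf] at key3
  exact key3

/-- Lifting a maximal ideal, given integrality near it. -/
lemma s6_lift {R S : Type*} [CommRing R] [CommRing S] (f : R →+* S) (m : Ideal R) [m.IsMaximal]
    (J : Ideal S) (hJ : J.comap f ≤ m)
    (hint : ∀ (φ : Localization.AtPrime m →+* Localization
        (m.primeCompl.map ((Ideal.Quotient.mk J).comp f)))
      (ψ : S →+* Localization (m.primeCompl.map ((Ideal.Quotient.mk J).comp f))),
      (∀ r, ψ (f r) = φ (algebraMap _ _ r)) → (∀ s ∈ J, ψ s = 0) → ∀ s, φ.IsIntegralElem (ψ s)) :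
    ∃ Q : Ideal S, Q.IsPrime ∧ J ≤ Q ∧ Q.comap f = m := by
  set M := m.primeCompl.map ((Ideal.Quotient.mk J).comp f) with hM
  let T := Localization M
  let ψ : S →+* T := (algebraMap (S ⧸ J) T).comp (Ideal.Quotient.mk J)
  have hu : ∀ y : m.primeCompl, IsUnit ((ψ.comp f) y) := fun y =>
    IsLocalization.map_units T (⟨_, Submonoid.mem_map_of_mem _ y.2⟩ : M)
  let φ : Localization.AtPrime m →+* T := IsLocalization.lift hu
  have hφ : ∀ r, ψ (f r) = φ (algebraMap _ _ r) := fun r => (IsLocalization.lift_eq hu r).symm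
  have hψJ : ∀ s ∈ J, ψ s = 0 := fun s hs => by
    simp [ψ, Ideal.Quotient.eq_zero_iff_mem.2 hs]
  have hi := hint φ ψ hφ hψJ
  have hφi : φ.IsIntegral := by
    intro z
    obtain ⟨a, b, rfl⟩ := IsLocalization.exists_mk'_eq M z
    obtain ⟨a, rfl⟩ := Ideal.Quotient.mk_surjective a
    obtain ⟨_, ⟨b, hb, rfl⟩⟩ := b
    have e : IsLocalization.mk' T (Ideal.Quotient.mk J a)
          (⟨_, Submonoid.mem_map_of_mem _ hb⟩ : M)
        = ψ a * φ (IsLocalization.mk' _ 1 (⟨b, hb⟩ : m.primeCompl)) := by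
      rw [IsLocalization.mk'_eq_iff_eq_mul]
      have h1 : φ (IsLocalization.mk' _ 1 (⟨b, hb⟩ : m.primeCompl)) * ψ (f b) = 1 := by
        rw [hφ, ← map_mul]
        have := IsLocalization.mk'_spec (Localization.AtPrime m) 1 (⟨b, hb⟩ : m.primeCompl)
        simp only at this
        rw [this, map_one, map_one]
      change ψ a = ψ a * _ * ψ (f b)
      rw [mul_assoc, h1, mul_one]
    rw [e]
    exact RingHom.IsIntegralElem.mul _ (hi a) (RingHom.isIntegralElem_map _)
  have hnt : Nontrivial T := by
    by_contra h
    rw [not_nontrivial_iff_subsingleton, IsLocalization.subsingleton_iff (M := M)] at h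
    obtain ⟨b, hb, hb0⟩ := h
    exact hb (hJ (show f b ∈ J from Ideal.Quotient.eq_zero_iff_mem.1 hb0))
  obtain ⟨Q, hQ⟩ := Ideal.exists_maximal T
  have hmax := Ideal.isMaximal_comap_of_isIntegral_of_isMaximal' φ hφi Q
  refine ⟨Q.comap ψ, inferInstance, fun s hs => by simp [Ideal.mem_comap, hψJ s hs], ?_⟩
  have h2 : Q.comap φ = IsLocalRing.maximalIdeal _ := IsLocalRing.eq_maximalIdeal hmax
  ext r
  rw [Ideal.mem_comap, Ideal.mem_comap, hφ, ← Ideal.mem_comap (f := φ), h2]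
  exact IsLocalization.AtPrime.to_map_mem_maximal_iff _ m r

lemma s6_int_six {R T : Type*} [CommRing R] [CommRing T] (φ : R →+* T) (x : T)
    (c5 c4 c3 c2 c1 c0 : R)
    (h : x ^ 6 + φ c5 * x ^ 5 + φ c4 * x ^ 4 + φ c3 * x ^ 3 + φ c2 * x ^ 2 + φ c1 * x + φ c0 = 0) :
    φ.IsIntegralElem x := by
  refine ⟨(Polynomial.X ^ 6 + Polynomial.C c5 * Polynomial.X ^ 5 + Polynomial.C c4 * Polynomial.X ^ 4 + Polynomial.C c3 * Polynomial.X ^ 3 + Polynomial.C c2 * Polynomial.X ^ 2 + Polynomial.C c1 * Polynomial.X + Polynomial.C c0 : Polynomial R),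
    by monicity!, by simpa using h⟩

lemma s6_int_eight {R T : Type*} [CommRing R] [CommRing T] (φ : R →+* T) (x : T)
    (A B c4 c3 c2 c1 c0 : R)
    (h : (x ^ 3 + φ A * x + φ B) *
      (x ^ 5 + φ c4 * x ^ 4 + φ c3 * x ^ 3 + φ c2 * x ^ 2 + φ c1 * x + φ c0) = 0) :
    φ.IsIntegralElem x := by
  refine ⟨(Polynomial.X ^ 3 + Polynomial.C A * Polynomial.X + Polynomial.C B : Polynomial R) *
    (Polynomial.X ^ 5 + Polynomial.C c4 * Polynomial.X ^ 4 + Polynomial.C c3 * Polynomial.X ^ 3 + Polynomial.C c2 * Polynomial.X ^ 2 + Polynomial.C c1 * Polynomial.X + Polynomial.C c0 : Polynomial R),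
    Polynomial.Monic.mul (by monicity!) (by monicity!), by simpa using h⟩

/-- The `x`-coordinate of a tangency point is integral, if `a3` or `2 * (2 a0 a3 - a1 ^ 2)`
is invertible. -/
lemma s6_int_x {R T : Type*} [CommRing R] [CommRing T] (φ : R →+* T) (x y : T)
    (A B a0 a1 a2 a3 a4 a5 : R)
    (hP : y ^ 2 - (x ^ 3 + φ A * x + φ B) = 0)
    (hq : φ a0 * x ^ 2 + φ a1 * x * y + φ a2 * x + φ a3 * y ^ 2 + φ a4 * y + φ a5 = 0)
    (hJ : (3 * x ^ 2 + φ A) * (φ a1 * x + 2 * φ a3 * y + φ a4)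
      + 2 * y * (2 * φ a0 * x + φ a1 * y + φ a2) = 0)
    (hu : IsUnit a3 ∨ IsUnit (2 * (2 * a0 * a3 - a1 ^ 2))) : φ.IsIntegralElem x := by
  -- `q = α + β y`, `N = α² - β² f`
  obtain ⟨f, hf⟩ : ∃ f, f = x ^ 3 + φ A * x + φ B := ⟨_, rfl⟩
  obtain ⟨f', hf'⟩ : ∃ f', f' = 3 * x ^ 2 + φ A := ⟨_, rfl⟩
  obtain ⟨α, hα⟩ : ∃ α, α = φ a3 * x ^ 3 + φ a0 * x ^ 2 + (φ a2 + φ a3 * φ A) * x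
    + (φ a5 + φ a3 * φ B) := ⟨_, rfl⟩
  obtain ⟨α', hα'⟩ : ∃ α', α' = 3 * φ a3 * x ^ 2 + 2 * φ a0 * x + (φ a2 + φ a3 * φ A) := ⟨_, rfl⟩
  obtain ⟨β, hβ⟩ : ∃ β, β = φ a1 * x + φ a4 := ⟨_, rfl⟩
  have h1 : y ^ 2 = f := by rw [hf]; linear_combination hP
  have h2 : α + β * y = 0 := by
    rw [hα, hβ]; linear_combination hq - φ a3 * hP
  have h3 : f' * β + 2 * y * α' + 2 * φ a1 * y ^ 2 = 0 := by
    rw [hf', hβ, hα']; linear_combination hJ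
  have hN : α ^ 2 - β ^ 2 * f = 0 := by
    linear_combination (α - β * y) * h2 + β ^ 2 * h1
  have hN' : 2 * f * (2 * α * α' - 2 * β * φ a1 * f - β ^ 2 * f') = 0 := by
    have h4 : 2 * y * (2 * α * α' - 2 * β * φ a1 * f - β ^ 2 * f') = 0 := by
      linear_combination 2 * α * h3 - 2 * β * f' * h2 - 4 * φ a1 * y * (y * h2 - β * h1)
    linear_combination y * h4 - 2 * (2 * α * α' - 2 * β * φ a1 * f - β ^ 2 * f') * h1
  obtain ⟨k4, hk4⟩ : ∃ k, k = a0 ^ 2 + 2 * a3 * (a2 + a3 * A) - 2 * a1 * a4 := ⟨_, rfl⟩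
  obtain ⟨k3, hk3⟩ : ∃ k, k = 2 * a3 * (a5 + a3 * B) + 2 * a0 * (a2 + a3 * A)
    - a4 ^ 2 - a1 ^ 2 * A := ⟨_, rfl⟩
  obtain ⟨k2, hk2⟩ : ∃ k, k = (a2 + a3 * A) ^ 2 + 2 * a0 * (a5 + a3 * B)
    - 2 * a1 * a4 * A - a1 ^ 2 * B := ⟨_, rfl⟩
  obtain ⟨k1, hk1⟩ : ∃ k, k = 2 * (a2 + a3 * A) * (a5 + a3 * B)
    - a4 ^ 2 * A - 2 * a1 * a4 * B := ⟨_, rfl⟩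
  obtain ⟨k0, hk0⟩ : ∃ k, k = (a5 + a3 * B) ^ 2 - a4 ^ 2 * B := ⟨_, rfl⟩
  rcases hu with hu | hu
  · obtain ⟨v, hv⟩ := hu.exists_right_inv
    have hv' := congrArg φ hv
    rw [map_mul, map_one] at hv'
    have hv2 : (φ a3 * φ v) ^ 2 = 1 := by rw [hv', one_pow]
    refine s6_int_six φ x (v ^ 2 * (2 * a0 * a3 - a1 ^ 2)) (v ^ 2 * k4) (v ^ 2 * k3) (v ^ 2 * k2)
      (v ^ 2 * k1) (v ^ 2 * k0) ?_
    rw [hk4, hk3, hk2, hk1, hk0]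
    rw [hα, hβ, hf] at hN
    simp only [map_add, map_sub, map_mul, map_pow, map_ofNat]
    linear_combination φ v ^ 2 * hN - x ^ 6 * hv2
  · obtain ⟨v, hv⟩ := hu.exists_right_inv
    have hv' := congrArg φ hv
    simp only [map_add, map_sub, map_mul, map_pow, map_ofNat, map_one] at hv'
    refine s6_int_eight φ x A B (v * 2 * 2 * k4) (v * 2 * 3 * k3) (v * 2 * 4 * k2)
      (v * 2 * 5 * k1) (v * 2 * 6 * k0) ?_
    have h5 : 2 * f * (6 * (α ^ 2 - β ^ 2 * f)
        - x * (2 * α * α' - 2 * β * φ a1 * f - β ^ 2 * f')) = 0 := by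
      linear_combination 12 * f * hN - x * hN'
    rw [hα, hα', hβ, hf, hf'] at h5
    rw [hk4, hk3, hk2, hk1, hk0]
    simp only [map_add, map_sub, map_mul, map_pow, map_ofNat]
    linear_combination φ v * h5 - (x ^ 3 + φ A * x + φ B) * x ^ 5 * hv'

lemma s6_affine_point {K : Type*} [Field K] [IsAlgClosed K] (h2 : (2 : K) ≠ 0)
    (A B a0 a1 a2 a3 a4 a5 : K) (h13 : a3 ≠ 0 ∨ a3 = 0 ∧ a1 ≠ 0)
    (hI : ∀ g ∈ elimIdeal K, eval ![A, B, a0, a1, a2, a3, a4, a5] g = 0) :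
    ∃ x y : K, y ^ 2 - (x ^ 3 + A * x + B) = 0 ∧
      a0 * x ^ 2 + a1 * x * y + a2 * x + a3 * y ^ 2 + a4 * y + a5 = 0 ∧
      (3 * x ^ 2 + A) * (a1 * x + 2 * a3 * y + a4) + 2 * y * (2 * a0 * x + a1 * y + a2) = 0 := by
  have n01 : ∀ i : Fin 10, i ≠ 0 → pderiv (R := K) (0 : Fin 10) (X i) = 0 :=
    fun i hi => pderiv_X_of_ne hi
  have n10 : ∀ i : Fin 10, i ≠ 1 → pderiv (R := K) (1 : Fin 10) (X i) = 0 :=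
    fun i hi => pderiv_X_of_ne hi
  have hJe : Jpq K = -((3 * X 0 ^ 2 + X 2) * (X 5 * X 0 + 2 * X 7 * X 1 + X 8)
      + 2 * X 1 * (2 * X 4 * X 0 + X 5 * X 1 + X 6)) := by
    simp [Jpq, Ptil, qtil, Derivation.leibniz, Derivation.leibniz_pow, n01, n10]
    ring
  set pars : Fin 8 → K := ![A, B, a0, a1, a2, a3, a4, a5] with hpars
  let m : Ideal (MvPolynomial (Fin 8) K) := vanishingIdeal K {pars}
  have hm : ∀ g, g ∈ m ↔ eval pars g = 0 := fun g => by
    simp [m, mem_vanishingIdeal_singleton_iff, aeval_eq_eval]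
  have : m.IsMaximal := inferInstanceAs (vanishingIdeal K {pars}).IsMaximal
  let f : MvPolynomial (Fin 8) K →+* MvPolynomial (Fin 10) K :=
    (rename paramEmb : MvPolynomial (Fin 8) K →ₐ[K] MvPolynomial (Fin 10) K).toRingHom
  have hfC : ∀ a, f (C a) = C a := fun a => by simp [f]
  have hfX : ∀ i, f (X i) = X (paramEmb i) := fun i => by simp [f]
  obtain ⟨J0, hJ0⟩ : ∃ J0, J0 = Ideal.span {Ptil K, qtil K, Jpq K} := ⟨_, rfl⟩
  have mP : Ptil K ∈ J0 := hJ0 ▸ Ideal.subset_span (by simp)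
  have mq : qtil K ∈ J0 := hJ0 ▸ Ideal.subset_span (by simp)
  have mJ : Jpq K ∈ J0 := hJ0 ▸ Ideal.subset_span (by simp)
  obtain ⟨Q, hQp, hQJ, hQm⟩ := s6_lift f m J0
    (fun g hg => (hm g).2 (hI g (by rw [hJ0] at hg; exact hg))) (by
      intro φ ψ hφ hψ
      have hs : ∀ i : Fin 8, ψ (X (paramEmb i)) = φ (algebraMap _ _ (X i)) := fun i => by
        rw [← hfX, hφ]
      have e2 : ψ (X 2) = _ := hs 0
      have e3 : ψ (X 3) = _ := hs 1
      have e4 : ψ (X 4) = _ := hs 2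
      have e5 : ψ (X 5) = _ := hs 3
      have e6 : ψ (X 6) = _ := hs 4
      have e7 : ψ (X 7) = _ := hs 5
      have e8 : ψ (X 8) = _ := hs 6
      have e9 : ψ (X 9) = _ := hs 7
      have hP := hψ (Ptil K) mP
      have hq := hψ (qtil K) mq
      have hJ := hψ (Jpq K) mJ
      rw [hJe, map_neg, neg_eq_zero] at hJ
      simp only [Ptil, qtil, map_add, map_sub, map_mul, map_pow, map_ofNat,
        e2, e3, e4, e5, e6, e7, e8, e9] at hP hq hJ
      have hx : φ.IsIntegralElem (ψ (X 0)) := by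
        refine s6_int_x φ (ψ (X 0)) (ψ (X 1)) _ _ _ _ _ _ _ _ hP hq hJ ?_
        have hun : ∀ g, eval pars g ≠ 0 → IsUnit (algebraMap _ (Localization.AtPrime m) g) :=
          fun g hg => IsLocalization.map_units (M := m.primeCompl) _
            ⟨g, fun h => hg ((hm g).1 h)⟩
        rcases h13 with h | ⟨h, h'⟩
        · left
          exact hun _ (by simpa [hpars] using h)
        · right
          have := hun (2 * (2 * X 2 * X 5 - X 3 ^ 2)) (by simp [hpars, h, h', h2])
          simpa only [map_add, map_sub, map_mul, map_pow, map_ofNat] using this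
      have hy : φ.IsIntegralElem (ψ (X 1)) := by
        have hy2 : φ.IsIntegralElem (ψ (X 1) ^ 2) := by
          rw [sub_eq_zero.1 hP]
          refine RingHom.IsIntegralElem.add _ (RingHom.IsIntegralElem.add _ ?_
            (RingHom.IsIntegralElem.mul _ (RingHom.isIntegralElem_map _) hx))
            (RingHom.isIntegralElem_map _)
          rw [pow_succ, pow_two]
          exact RingHom.IsIntegralElem.mul _ (RingHom.IsIntegralElem.mul _ hx hx) hx
        letI := φ.toAlgebra
        exact IsIntegral.of_pow (n := 2) (by norm_num) hy2
      intro s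
      induction s using MvPolynomial.induction_on with
      | C a =>
        rw [← hfC, hφ]
        exact RingHom.isIntegralElem_map _
      | add p q hp hq =>
        rw [map_add]
        exact RingHom.IsIntegralElem.add _ hp hq
      | mul_X p i hp =>
        rw [map_mul]
        refine RingHom.IsIntegralElem.mul _ hp ?_
        obtain rfl | rfl | ⟨j, rfl⟩ : i = 0 ∨ i = 1 ∨ ∃ j, i = paramEmb j := by
          revert i; decide
        · exact hx
        · exact hy
        · rw [hs]
          exact RingHom.isIntegralElem_map _)
  obtain ⟨M, hM, hQM⟩ := Ideal.exists_le_maximal Q hQp.ne_top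
  obtain ⟨pt, rfl⟩ := isMaximal_iff_eq_vanishingIdeal_singleton.1 hM
  have hpt : ∀ i, pt (paramEmb i) = pars i := by
    intro i
    have h1 : X i - C (pars i) ∈ m := (hm _).2 (by simp)
    rw [← hQm, Ideal.mem_comap] at h1
    have h3 := hQM h1
    rw [mem_vanishingIdeal_singleton_iff, map_sub, hfX, hfC] at h3
    simpa [sub_eq_zero] using h3
  have e2 : pt 2 = A := hpt 0
  have e3 : pt 3 = B := hpt 1
  have e4 : pt 4 = a0 := hpt 2
  have e5 : pt 5 = a1 := hpt 3
  have e6 : pt 6 = a2 := hpt 4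
  have e7 : pt 7 = a3 := hpt 5
  have e8 : pt 8 = a4 := hpt 6
  have e9 : pt 9 = a5 := hpt 7
  have hP := hQM (hQJ mP)
  have hq := hQM (hQJ mq)
  have hJ := hQM (hQJ mJ)
  rw [mem_vanishingIdeal_singleton_iff] at hP hq hJ
  rw [hJe, map_neg, neg_eq_zero] at hJ
  simp only [Ptil, qtil, map_add, map_sub, map_mul, map_pow, map_ofNat, aeval_X,
    e2, e3, e4, e5, e6, e7, e8, e9] at hP hq hJ
  exact ⟨pt 0, pt 1, hP, hq, hJ⟩

/-- over an algebraically closed field of characteristic `p ≥ 5`, for any values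
`(A, B, a0, …, a5) ∈ K⁸`, the curve `C = V(P,Q) ⊂ ℙ³` is nonsingular iff `4A³ + 27B² ≠ 0`
and some element of the elimination ideal `I` has nonzero value at `(A, B, a0, …, a5)`. -/
theorem stmt6 {K : Type*} [Field K] [IsAlgClosed K] (p : ℕ) [CharP K p] (hp : 5 ≤ p)
    (A B a0 a1 a2 a3 a4 a5 : K) :
    (∀ v : Fin 4 → K, v ≠ 0 →
        eval v (Pcubic K A B) = 0 → eval v (Qquad K a0 a1 a2 a3 a4 a5) = 0 →
        ¬ (jacMat (Pcubic K A B) (Qquad K a0 a1 a2 a3 a4 a5) v).rank ≤ 1) ↔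
      (4 * A ^ 3 + 27 * B ^ 2 ≠ 0 ∧
        ∃ g ∈ elimIdeal K, eval ![A, B, a0, a1, a2, a3, a4, a5] g ≠ 0) := by
  have hpr : p.Prime := (CharP.char_is_prime_or_zero K p).resolve_right (by omega)
  have hsmall : ∀ n : ℕ, 0 < n → n < 5 → (n : K) ≠ 0 := by
    intro n h0 h5 h
    have := Nat.le_of_dvd h0 ((CharP.cast_eq_zero_iff K p n).1 h)
    omega
  have h2 : (2 : K) ≠ 0 := by exact_mod_cast hsmall 2 (by norm_num) (by norm_num)
  have h3 : (3 : K) ≠ 0 := by exact_mod_cast hsmall 3 (by norm_num) (by norm_num)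
  constructor
  · intro H
    refine ⟨?_, ?_⟩
    · -- a singular point of the cubic gives a singular point of the curve
      intro hD
      obtain ⟨x, hx1, hx2⟩ : ∃ x : K, x ^ 3 + A * x + B = 0 ∧ 3 * x ^ 2 + A = 0 := by
        by_cases hA : A = 0
        · have hB : B = 0 := by
            have h27 : (3 : K) ^ 3 * B ^ 2 = 0 := by rw [hA] at hD; linear_combination hD
            simpa [h3] using h27
          exact ⟨0, by simp [hB], by simp [hA]⟩
        · refine ⟨-3 * B / (2 * A), ?_, ?_⟩
          · field_simp
            linear_combination -B * hD
          · field_simp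
            linear_combination hD
      obtain ⟨w, hw⟩ := IsAlgClosed.exists_pow_nat_eq (a0 * x ^ 2 + a2 * x + a5) (n := 2)
        (by norm_num)
      refine H ![x, 0, 1, w] ?_ ?_ ?_ ?_
      · intro h
        simpa using congrFun h 2
      · rw [s6_evalP]; linear_combination -hx1
      · rw [s6_evalQ]; linear_combination hw
      · rw [s6_sing]
        refine ⟨1, 0, by simp, ?_, by simp, ?_, by simp⟩
        · linear_combination hx2
        · linear_combination -3 * hx1 + x * hx2
    · by_contra hI
      push Not at hI
      by_cases h13 : a3 = 0 ∧ a1 = 0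
      · obtain ⟨rfl, rfl⟩ := h13
        refine H ![0, 1, 0, 0] ?_ ?_ ?_ ?_
        · intro h
          simpa using congrFun h 1
        · rw [s6_evalP]; ring
        · rw [s6_evalQ]; ring
        · rw [s6_sing]
          exact ⟨a4, 1, by simp, by ring, by ring, by ring, by ring⟩
      · obtain ⟨x, y, hP, hq, hJ⟩ := s6_affine_point h2 A B a0 a1 a2 a3 a4 a5 (by tauto) hI
        refine H ![x, y, 1, 0] ?_ ?_ ?_ ?_
        · intro h
          simpa using congrFun h 2
        · rw [s6_evalP]; linear_combination hP
        · rw [s6_evalQ]; linear_combination -hq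
        · rw [s6_sing]
          by_cases hx : 3 * x ^ 2 + A = 0
          · by_cases hy : y = 0
            · subst hy
              refine ⟨1, 0, by simp, ?_, by simp, ?_, by simp⟩
              · linear_combination hx
              · linear_combination 3 * hP + x * hx
            · refine ⟨a1 * x + 2 * a3 * y + a4, 2 * y, Or.inr (mul_ne_zero h2 hy), ?_, ?_, ?_,
                by ring⟩
              · linear_combination hJ
              · ring
              · linear_combination x * hJ + 3 * (a1 * x + 2 * a3 * y + a4) * hP - 4 * y * hq
          · refine ⟨-(2 * a0 * x + a1 * y + a2), 3 * x ^ 2 + A, Or.inr hx, ?_, ?_, ?_, by ring⟩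
            · ring
            · linear_combination -hJ
            · linear_combination y * hJ - 3 * (2 * a0 * x + a1 * y + a2) * hP
                - 2 * (3 * x ^ 2 + A) * hq
  · rintro ⟨hD, g, hg, hg0⟩ v hv hvP hvQ hvR
    obtain ⟨x, y, z, w, rfl⟩ : ∃ x y z w, v = ![x, y, z, w] :=
      ⟨v 0, v 1, v 2, v 3, by funext i; fin_cases i <;> rfl⟩
    rw [s6_evalP] at hvP
    rw [s6_evalQ] at hvQ
    rw [s6_sing] at hvR
    obtain ⟨s, t, hst, e1, e2, e3, e4⟩ := hvR
    by_cases hz : z = 0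
    · subst hz
      have hx : x = 0 := by
        have : x ^ 3 = 0 := by linear_combination -hvP
        simpa using this
      subst hx
      have hy : y ≠ 0 := by
        rintro rfl
        have hw : w = 0 := by
          have : w ^ 2 = 0 := by linear_combination hvQ
          simpa using this
        subst hw
        apply hv
        funext i
        fin_cases i <;> rfl
      have ht : t ≠ 0 := by
        rintro rfl
        have : s * y ^ 2 = 0 := by linear_combination e3
        simp [hy] at this
        simp [this] at hst
      have h1 : a1 = 0 := by
        have : t * y * a1 = 0 := by linear_combination e1
        simpa [ht, hy] using this
      have h3 : a3 = 0 := by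
        have : t * y * 2 * a3 = 0 := by linear_combination -e2
        simpa [ht, hy, h2] using this
      subst h1
      subst h3
      exact hg0 (s6_infinity A B a0 a2 a4 a5 g hg)
    · obtain ⟨x, rfl⟩ : ∃ x', x = x' * z := ⟨x / z, by field_simp⟩
      obtain ⟨y, rfl⟩ : ∃ y', y = y' * z := ⟨y / z, by field_simp⟩
      have hP : y ^ 2 - (x ^ 3 + A * x + B) = 0 := by
        have : z ^ 3 * (y ^ 2 - (x ^ 3 + A * x + B)) = 0 := by linear_combination hvP
        simpa [hz] using this
      by_cases hw : w = 0
      · subst hw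
        have hq : a0 * x ^ 2 + a1 * x * y + a2 * x + a3 * y ^ 2 + a4 * y + a5 = 0 := by
          have : z ^ 2 * (a0 * x ^ 2 + a1 * x * y + a2 * x + a3 * y ^ 2 + a4 * y + a5) = 0 := by
            linear_combination -hvQ
          simpa [hz] using this
        have f1 : s * z * (3 * x ^ 2 + A) + t * (2 * a0 * x + a1 * y + a2) = 0 := by
          have : z * (s * z * (3 * x ^ 2 + A) + t * (2 * a0 * x + a1 * y + a2)) = 0 := by
            linear_combination e1
          simpa [hz] using this
        have f2 : s * z * (2 * y) - t * (a1 * x + 2 * a3 * y + a4) = 0 := by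
          have : z * (s * z * (2 * y) - t * (a1 * x + 2 * a3 * y + a4)) = 0 := by
            linear_combination e2
          simpa [hz] using this
        have hJ : (3 * x ^ 2 + A) * (a1 * x + 2 * a3 * y + a4)
            + 2 * y * (2 * a0 * x + a1 * y + a2) = 0 := by
          rcases hst with hs | ht
          · have : s * z * ((3 * x ^ 2 + A) * (a1 * x + 2 * a3 * y + a4)
                + 2 * y * (2 * a0 * x + a1 * y + a2)) = 0 := by
              linear_combination (a1 * x + 2 * a3 * y + a4) * f1 + (2 * a0 * x + a1 * y + a2) * f2
            exact (mul_eq_zero.1 this).resolve_left (mul_ne_zero hs hz)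
          · have : t * ((3 * x ^ 2 + A) * (a1 * x + 2 * a3 * y + a4)
                + 2 * y * (2 * a0 * x + a1 * y + a2)) = 0 := by
              linear_combination 2 * y * f1 - (3 * x ^ 2 + A) * f2
            exact (mul_eq_zero.1 this).resolve_left ht
        exact hg0 (s6_elim_vanish (RingHom.id K) x y A B a0 a1 a2 a3 a4 a5 hP hq hJ g hg)
      · have ht : t = 0 := by simpa [hw, h2] using e4
        subst ht
        have hs : s ≠ 0 := by simpa using hst
        have f1 : 3 * x ^ 2 + A = 0 := by
          have : s * z ^ 2 * (3 * x ^ 2 + A) = 0 := by linear_combination e1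
          exact (mul_eq_zero.1 this).resolve_left (mul_ne_zero hs (pow_ne_zero _ hz))
        have f2 : y = 0 := by
          have : s * z ^ 2 * 2 * y = 0 := by linear_combination e2
          exact (mul_eq_zero.1 this).resolve_left
            (mul_ne_zero (mul_ne_zero hs (pow_ne_zero _ hz)) h2)
        subst f2
        apply hD
        linear_combination (18 * A * x - 27 * B) * hP + (6 * A * x ^ 2 - 9 * B * x + 4 * A ^ 2) * f1

end
end

section
/- Let K be a field of characteristic 0 or p ≥ 5. Define G(x) := (a1·x + a4)²·(x³ + A·x + B) − (a3·(x³ + A·x + B) + a0·x² + a2·x + a5)² in K[A, B, a0, a1, a2, a3, a4, a5][x], and let G′ denote its derivative with respect to x. Then f3² divides the resultant Res_x(G, G′) ∈ K[A, B, a0, ..., a5] of G and G′ with respect to x. (This expresses that the discriminant Δ of G is divisible by f3², so that the quotient f2 = Δ/f3² is again a polynomial.) -/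
open MvPolynomial

noncomputable section

/-- The Sylvester matrix of two polynomials `f` (regarded of degree `m`) and `g` (regarded of
degree `n`): an `(n+m) × (n+m)` matrix whose first `n` rows contain the shifted coefficient
sequences of `f` and whose last `m` rows contain the shifted coefficient sequences of `g`. -/
def sylvester {S : Type*} [CommRing S] (m n : ℕ) (f g : Polynomial S) :
    Matrix (Fin (n + m)) (Fin (n + m)) S :=
  Matrix.of fun i j =>
    if (i : ℕ) < n then
      (if (j : ℕ) ≤ m + (i : ℕ) then f.coeff (m + (i : ℕ) - (j : ℕ)) else 0)
    else
      (if (j : ℕ) ≤ n + ((i : ℕ) - n) then g.coeff (n + ((i : ℕ) - n) - (j : ℕ)) else 0)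

/-- The parameter polynomial ring `K[A, B, a0, …, a5]` (`A = 0`, `B = 1`, `aᵢ = i + 2`). -/
abbrev Kparam (K : Type*) [Field K] := MvPolynomial (Fin 8) K

/-- `G(x) = (a1·x + a4)²·(x³ + A·x + B) − (a3·(x³ + A·x + B) + a0·x² + a2·x + a5)²`
in `K[A, B, a0, …, a5][x]`. -/
def Gpoly (K : Type*) [Field K] : Polynomial (Kparam K) :=
  (Polynomial.C (X 3) * Polynomial.X + Polynomial.C (X 6)) ^ 2 *
      (Polynomial.X ^ 3 + Polynomial.C (X 0) * Polynomial.X + Polynomial.C (X 1)) -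
    (Polynomial.C (X 5) *
        (Polynomial.X ^ 3 + Polynomial.C (X 0) * Polynomial.X + Polynomial.C (X 1)) +
      Polynomial.C (X 2) * Polynomial.X ^ 2 + Polynomial.C (X 4) * Polynomial.X +
      Polynomial.C (X 7)) ^ 2

/-- Determinant divisibility from two columns whose entries are divisible off one row. -/
theorem sq_dvd_det_aux {S : Type*} [CommRing S] {n : ℕ} (M : Matrix (Fin n) (Fin n) S) (q : S)
    (c d r : Fin n) (hcd : c ≠ d) (h0 : ∀ i, i ≠ r → q ^ 2 ∣ M i c) (h1 : q ∣ M r c)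
    (h2 : ∀ i, i ≠ r → q ∣ M i d) : q ^ 2 ∣ M.det := by
  rw [Matrix.det_apply]
  refine Finset.dvd_sum fun σ _ => ?_
  rw [Units.smul_def, zsmul_eq_mul]
  refine Dvd.dvd.mul_left ?_ _
  rw [← Finset.mul_prod_erase Finset.univ _ (Finset.mem_univ c)]
  by_cases hs : σ c = r
  · have hd : d ∈ Finset.univ.erase c := by simp [hcd.symm]
    rw [← Finset.mul_prod_erase _ _ hd, ← mul_assoc, pow_two]
    refine Dvd.dvd.mul_right (mul_dvd_mul (hs ▸ h1) (h2 _ ?_)) _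
    intro h
    exact hcd (σ.injective (hs.trans h.symm))
  · exact Dvd.dvd.mul_right (h0 _ hs) _

/-- The frozen Sylvester determinant is Mathlib's resultant. -/
theorem det_sylvester_eq {S : Type*} [CommRing S] (f g : Polynomial S)
    (hf : f.natDegree ≤ 6) (hg : g.natDegree ≤ 5) :
    (sylvester 6 5 f g).det = f.resultant g 6 5 := by
  have : sylvester 6 5 f g =
      ((Polynomial.sylvester f g 6 5).transpose.submatrix Fin.revPerm Fin.revPerm) := by
    have hf' : ∀ k, 6 < k → f.coeff k = 0 := fun k hk =>
      Polynomial.coeff_eq_zero_of_natDegree_lt (by omega)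
    have hg' : ∀ k, 5 < k → g.coeff k = 0 := fun k hk =>
      Polynomial.coeff_eq_zero_of_natDegree_lt (by omega)
    ext i j
    obtain ⟨i, hi⟩ := i
    obtain ⟨j, hj⟩ := j
    simp only [sylvester, Polynomial.sylvester, Matrix.of_apply, Matrix.submatrix_apply,
      Matrix.transpose_apply, Fin.revPerm_apply, Fin.rev, Fin.addCases, Set.mem_Icc]
    by_cases h : i < 5
    · rw [if_pos h, dif_neg (by omega)]
      simp only [Fin.val_subNat, Fin.val_cast, eq_rec_constant]
      split_ifs with h1 h2 h2
      · congr 1; omega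
      · exact hf' _ (by omega)
      · omega
      · rfl
    · rw [if_neg h, dif_pos (by omega)]
      simp only [Fin.val_castLT]
      split_ifs with h1 h2 h2
      · congr 1; omega
      · exact hg' _ (by omega)
      · omega
      · rfl
  rw [this]
  rw [Matrix.det_submatrix_equiv_self, Matrix.det_transpose]
  rfl

/-- If `q² ∣ c₀` and `q ∣ c₁`, then `q²` divides the resultant of `f` and its derivative. -/
theorem sq_dvd_resultant {S : Type*} [CommRing S] (f : Polynomial S) (q : S)
    (hf : f.natDegree ≤ 6) (h0 : q ^ 2 ∣ f.coeff 0) (h1 : q ∣ f.coeff 1) :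
    q ^ 2 ∣ f.resultant f.derivative 6 5 := by
  rw [← det_sylvester_eq f _ hf ((Polynomial.natDegree_derivative_le f).trans (by omega))]
  have h0' : q ∣ f.coeff 0 := (dvd_pow_self q two_ne_zero).trans h0
  refine sq_dvd_det_aux _ q 10 9 10 (by decide) ?_ ?_ ?_
  · intro i hi
    fin_cases i <;> simp [sylvester] at hi ⊢
    exact h0
  · simp [sylvester, Polynomial.coeff_derivative]
    exact h1
  · intro i hi
    fin_cases i <;> simp [sylvester, Polynomial.coeff_derivative] at hi ⊢
    all_goals first | exact h0' | exact h1

theorem sylvester_shift {S : Type*} [CommRing S] (f : Polynomial S) (s t q : S)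
    (hf : f.natDegree = 6) (hf' : f.derivative.natDegree = 5)
    (h0 : q ^ 2 ∣ (f.scaleRoots s).eval t) (h1 : q ∣ (f.scaleRoots s).derivative.eval t) :
    q ^ 2 ∣ s ^ 30 * (sylvester 6 5 f f.derivative).det := by
  have hd : (f.scaleRoots s).derivative = f.derivative.scaleRoots s := by
    ext i
    simp only [Polynomial.coeff_derivative, Polynomial.coeff_scaleRoots, hf, hf']
    rw [show 6 - (i + 1) = 5 - i by omega]
    ring
  have ht : (Polynomial.taylor t (f.scaleRoots s)).derivative =
      Polynomial.taylor t (f.scaleRoots s).derivative := by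
    simp [Polynomial.taylor_apply, Polynomial.derivative_comp]
  have key := sq_dvd_resultant (Polynomial.taylor t (f.scaleRoots s)) q
    (by rw [Polynomial.natDegree_taylor, Polynomial.natDegree_scaleRoots, hf])
    (by rwa [Polynomial.taylor_coeff_zero]) (by rwa [Polynomial.taylor_coeff_one])
  have e1 := Polynomial.resultant_taylor (f.scaleRoots s) (f.derivative.scaleRoots s) t
  have e2 := Polynomial.resultant_scaleRoots f f.derivative s
  simp only [Polynomial.natDegree_taylor, Polynomial.natDegree_scaleRoots, hf, hf'] at e1 e2
  rw [ht, hd, e1, e2, ← det_sylvester_eq f _ hf.le hf'.le] at key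
  exact key

theorem G_expand {S : Type*} [CommRing S] (A B a0 a1 a2 a3 a4 a5 : S) (G : Polynomial S)
    (hG : G = (Polynomial.C a1 * Polynomial.X + Polynomial.C a4) ^ 2 *
      (Polynomial.X ^ 3 + Polynomial.C A * Polynomial.X + Polynomial.C B) -
    (Polynomial.C a3 *
        (Polynomial.X ^ 3 + Polynomial.C A * Polynomial.X + Polynomial.C B) +
      Polynomial.C a0 * Polynomial.X ^ 2 + Polynomial.C a2 * Polynomial.X +
      Polynomial.C a5) ^ 2) :
    G = Polynomial.C (-a3 ^ 2) * Polynomial.X ^ 6 +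
      Polynomial.C (a1 ^ 2 - 2 * a3 * a0) * Polynomial.X ^ 5 +
      Polynomial.C (2 * a1 * a4 - a0 ^ 2 - 2 * a3 * (a3 * A + a2)) * Polynomial.X ^ 4 +
      Polynomial.C (a4 ^ 2 + a1 ^ 2 * A - 2 * a3 * (a3 * B + a5) - 2 * a0 * (a3 * A + a2))
        * Polynomial.X ^ 3 +
      Polynomial.C (a1 ^ 2 * B + 2 * a1 * a4 * A - (a3 * A + a2) ^ 2 - 2 * a0 * (a3 * B + a5))
        * Polynomial.X ^ 2 +
      Polynomial.C (2 * a1 * a4 * B + a4 ^ 2 * A - 2 * (a3 * A + a2) * (a3 * B + a5))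
        * Polynomial.X +
      Polynomial.C (a4 ^ 2 * B - (a3 * B + a5) ^ 2) := by
  rw [hG]
  simp only [map_add, map_sub, map_mul, map_pow, map_neg, map_ofNat]
  ring

theorem G_dvd {S : Type*} [CommRing S] (A B a0 a1 a2 a3 a4 a5 : S) (G : Polynomial S)
    (hG : G = (Polynomial.C a1 * Polynomial.X + Polynomial.C a4) ^ 2 *
      (Polynomial.X ^ 3 + Polynomial.C A * Polynomial.X + Polynomial.C B) -
    (Polynomial.C a3 *
        (Polynomial.X ^ 3 + Polynomial.C A * Polynomial.X + Polynomial.C B) +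
      Polynomial.C a0 * Polynomial.X ^ 2 + Polynomial.C a2 * Polynomial.X +
      Polynomial.C a5) ^ 2) (h6 : (6 : S) * a3 ^ 2 ≠ 0) (f3 : S)
    (hf3 : f3 = A * a1 ^ 2 * a3 * a4 - B * a1 ^ 3 * a3 - a0 * a1 * a4 ^ 2
      - a1 ^ 3 * a5 + a1 ^ 2 * a2 * a4 + a3 * a4 ^ 3) :
    f3 ^ 2 ∣ a1 ^ 30 * (sylvester 6 5 G G.derivative).det := by
  have hE := G_expand A B a0 a1 a2 a3 a4 a5 G hG
  have c6 : G.coeff 6 = -a3 ^ 2 := by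
    rw [hE]; simp [Polynomial.coeff_X, Polynomial.coeff_C, Polynomial.coeff_X_pow, -map_add, -map_sub,
      -map_mul, -map_pow, -map_neg]
  have hdle : G.natDegree ≤ 6 := by rw [hE]; compute_degree
  have hdeg : G.natDegree = 6 := by
    refine le_antisymm hdle (Polynomial.le_natDegree_of_ne_zero ?_)
    rw [c6]
    intro h
    exact h6 (by linear_combination -6 * h)
  have hdeg' : G.derivative.natDegree = 5 := by
    refine le_antisymm ((Polynomial.natDegree_derivative_le G).trans (by omega))
      (Polynomial.le_natDegree_of_ne_zero ?_)
    rw [Polynomial.coeff_derivative, c6]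
    intro h
    exact h6 (by push_cast at h; linear_combination -h)
  have c5 : G.coeff 5 = a1 ^ 2 - 2 * a3 * a0 := by
    rw [hE]; simp [Polynomial.coeff_X, Polynomial.coeff_C, Polynomial.coeff_X_pow, -map_add, -map_sub,
      -map_mul, -map_pow, -map_neg]
  have c4 : G.coeff 4 = 2 * a1 * a4 - a0 ^ 2 - 2 * a3 * (a3 * A + a2) := by
    rw [hE]; simp [Polynomial.coeff_X, Polynomial.coeff_C, Polynomial.coeff_X_pow, -map_add, -map_sub,
      -map_mul, -map_pow, -map_neg]
  have c3 : G.coeff 3 = a4 ^ 2 + a1 ^ 2 * A - 2 * a3 * (a3 * B + a5)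
      - 2 * a0 * (a3 * A + a2) := by
    rw [hE]; simp [Polynomial.coeff_X, Polynomial.coeff_C, Polynomial.coeff_X_pow, -map_add, -map_sub,
      -map_mul, -map_pow, -map_neg]
  have c2 : G.coeff 2 = a1 ^ 2 * B + 2 * a1 * a4 * A - (a3 * A + a2) ^ 2
      - 2 * a0 * (a3 * B + a5) := by
    rw [hE]; simp [Polynomial.coeff_X, Polynomial.coeff_C, Polynomial.coeff_X_pow, -map_add, -map_sub,
      -map_mul, -map_pow, -map_neg]
  have c1 : G.coeff 1 = 2 * a1 * a4 * B + a4 ^ 2 * A - 2 * (a3 * A + a2) * (a3 * B + a5) := by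
    rw [hE]; simp [Polynomial.coeff_X, Polynomial.coeff_C, Polynomial.coeff_X_pow, -map_add, -map_sub,
      -map_mul, -map_pow, -map_neg]
  have c0 : G.coeff 0 = a4 ^ 2 * B - (a3 * B + a5) ^ 2 := by
    rw [hE]; simp [Polynomial.coeff_X, Polynomial.coeff_C, Polynomial.coeff_X_pow, -map_add, -map_sub,
      -map_mul, -map_pow, -map_neg]
  have hsd : (G.scaleRoots a1).natDegree = 6 := by rw [Polynomial.natDegree_scaleRoots, hdeg]
  refine sylvester_shift G a1 (-a4) f3 hdeg hdeg' ⟨-1, ?_⟩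
    ⟨2 * (3 * a3 * a4 ^ 2 + a3 * A * a1 ^ 2 - 2 * a0 * a1 * a4 + a2 * a1 ^ 2), ?_⟩
  · rw [Polynomial.eval_eq_sum_range, hsd]
    simp only [Finset.sum_range_succ, Finset.sum_range_zero, Polynomial.coeff_scaleRoots, hdeg,
      c0, c1, c2, c3, c4, c5, c6, hf3, Nat.reduceSub]
    ring
  · rw [Polynomial.eval_eq_sum_range' (n := 6)
      (lt_of_le_of_lt (Polynomial.natDegree_derivative_le _) (by omega))]
    simp only [Finset.sum_range_succ, Finset.sum_range_zero, Polynomial.coeff_derivative,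
      Polynomial.coeff_scaleRoots, hdeg,
      c0, c1, c2, c3, c4, c5, c6, hf3, Nat.reduceSub, Nat.reduceAdd]
    push_cast
    ring

theorem cancel_aux {S : Type*} [CommRing S] [IsDomain S] {p a b h : S} (hp : Prime p) (n : ℕ)
    (hnd : ¬ p ∣ a) (hh : p ^ n * b = a * h) : a ∣ b := by
  obtain ⟨w, rfl⟩ := hp.pow_dvd_of_dvd_mul_left n hnd (Dvd.intro _ hh)
  refine ⟨w, mul_left_cancel₀ (pow_ne_zero n hp.ne_zero) ?_⟩
  rw [hh]; ring

theorem six_ne_zero_of_char {K : Type*} [Field K] (hchar : ringChar K = 0 ∨ 5 ≤ ringChar K) :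
    (6 : K) ≠ 0 := by
  intro h
  have h6 : ((6 : ℕ) : K) = 0 := by exact_mod_cast h
  have hd := (ringChar.spec K 6).1 h6
  rcases CharP.char_is_prime_or_zero K (ringChar K) with hp | hp
  · have : ringChar K ≤ 6 := Nat.le_of_dvd (by norm_num) hd
    rcases hchar with hc | hc
    · rw [hc] at hp; exact Nat.not_prime_zero hp
    · interval_cases hr : ringChar K
      · omega
      · exact absurd hp (by norm_num)
  · rw [hp] at hd; omega

/-- `f3²` divides the resultant `Res_x(G, G′)`, the latter computed as the
determinant of the 11×11 Sylvester matrix of `G` (degree 6) and its derivative `G′`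
(degree 5). -/
theorem stmt10 {K : Type*} [Field K] (hchar : ringChar K = 0 ∨ 5 ≤ ringChar K) :
    f3poly K ^ 2 ∣
      (sylvester 6 5 (Gpoly K) (Polynomial.derivative (Gpoly K))).det := by
  have h6 : (6 : Kparam K) * X 5 ^ 2 ≠ 0 := by
    refine mul_ne_zero ?_ (pow_ne_zero _ (X_ne_zero _))
    have : (6 : Kparam K) = C 6 := (map_ofNat C 6).symm
    rw [this, Ne, C_eq_zero]
    exact six_ne_zero_of_char hchar
  obtain ⟨h, hh⟩ := G_dvd (X 0 : Kparam K) (X 1) (X 2) (X 3) (X 4) (X 5) (X 6) (X 7) (Gpoly K) rfl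
    h6 (f3poly K) rfl
  have hp : Prime (X 3 : Kparam K) := X_prime
  have hnd : ¬ (X 3 : Kparam K) ∣ f3poly K ^ 2 := by
    intro hd
    obtain ⟨u, hu⟩ := hp.dvd_of_dvd_pow hd
    have := congrArg (MvPolynomial.eval (fun i : Fin 8 => if i = 3 then (0 : K) else 1)) hu
    simp [f3poly] at this
  exact cancel_aux hp 30 hnd hh

end
end

section
/- Let p ≥ 5 be a prime, let K be a field of characteristic p, and fix A, B, a0, a1, a2, a3, a4, a5 ∈ K. Then the coefficient of the monomial x^{p−1}·y^{p−1}·z^{p−1}·w^{2p−2} in (P·Q)^{p−1} ∈ K[x,y,z,w] equals the coefficient of t^{p−1} in the single-variable polynomial (t³ + A·t + B)^{(p−1)/2} ∈ K[t]. (This identifies the (1,1)-entry of the Hasse–Witt matrix of C = V(P,Q) with the Deuring polynomial coefficient whose vanishing characterizes supersingularity of the elliptic curve y² = x³ + Ax + B.) -/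
open MvPolynomial

noncomputable section

theorem aux_coeff_X_pow_mul {K : Type*} [Field K] (i : Fin 4) (g : MvPolynomial (Fin 4) K)
    (hg : g ∈ supported K {j : Fin 4 | j ≠ i}) (k : ℕ) (d : Fin 4 →₀ ℕ) :
    coeff d (X i ^ k * g) = if d i = k then coeff (d.erase i) g else 0 := by
  classical
  have hz : ∀ e : Fin 4 →₀ ℕ, e i ≠ 0 → coeff e g = 0 := by
    intro e he
    by_contra hne
    have h1 : i ∈ g.vars := (mem_vars_iff_mem_support i).2
      ⟨e, mem_support_iff.2 hne, Finsupp.mem_support_iff.2 he⟩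
    exact (mem_supported.1 hg h1) rfl
  rw [X_pow_eq_monomial, coeff_monomial_mul', one_mul]
  by_cases hk : d i = k
  · rw [if_pos (by rw [Finsupp.single_le_iff]; omega), if_pos hk]
    congr 1
    ext j
    by_cases hj : j = i
    · subst hj; simp [hk]
    · simp [Finsupp.erase_ne hj, Finsupp.single_eq_of_ne hj]
  · rw [if_neg hk]
    split_ifs with h
    · rw [Finsupp.single_le_iff] at h
      apply hz
      simp
      omega
    · rfl

theorem aux_coeff_binom {K : Type*} [Field K] (i : Fin 4) (h u v : MvPolynomial (Fin 4) K)
    (hh : h ∈ supported K {j : Fin 4 | j ≠ i})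
    (hu : u ∈ supported K {j : Fin 4 | j ≠ i})
    (hv : v ∈ supported K {j : Fin 4 | j ≠ i})
    (n k : ℕ) (hk : k ≤ n) (d : Fin 4 →₀ ℕ) (hd : d i = 2 * k) :
    coeff d (h * (X i ^ 2 * u + v) ^ n) =
      (n.choose k : K) * coeff (d.erase i) (h * (u ^ k * v ^ (n - k))) := by
  rw [add_pow, Finset.mul_sum, coeff_sum, Finset.sum_eq_single k]
  · rw [show h * ((X i ^ 2 * u) ^ k * v ^ (n - k) * ((n.choose k : ℕ) : MvPolynomial (Fin 4) K)) =
      X i ^ (2 * k) * (C (n.choose k : K) * (h * (u ^ k * v ^ (n - k)))) by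
        rw [map_natCast, mul_pow, ← pow_mul]; ring]
    rw [aux_coeff_X_pow_mul i _ _ _ d, if_pos hd, coeff_C_mul]
    exact mul_mem (Subalgebra.algebraMap_mem _ _)
      (mul_mem hh (mul_mem (pow_mem hu _) (pow_mem hv _)))
  · intro b _ hb
    rw [show h * ((X i ^ 2 * u) ^ b * v ^ (n - b) * ((n.choose b : ℕ) : MvPolynomial (Fin 4) K)) =
      X i ^ (2 * b) * (C (n.choose b : K) * (h * (u ^ b * v ^ (n - b)))) by
        rw [map_natCast, mul_pow, ← pow_mul]; ring]
    rw [aux_coeff_X_pow_mul i _ _ _ d, if_neg (by omega)]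
    exact mul_mem (Subalgebra.algebraMap_mem _ _)
      (mul_mem hh (mul_mem (pow_mem hu _) (pow_mem hv _)))
  · intro hn
    exact absurd (Finset.mem_range.2 (by omega)) hn

theorem aux_choose {K : Type*} [Field K] (p : ℕ) (hp : p.Prime) [CharP K p] (k : ℕ)
    (hk : k ≤ p - 1) : ((p - 1).choose k : K) = (-1) ^ k := by
  induction k with
  | zero => simp
  | succ k ih =>
    have h1 : p.choose (k + 1) = (p - 1).choose k + (p - 1).choose (k + 1) := by
      obtain ⟨q, rfl⟩ : ∃ q, p = q + 1 := ⟨p - 1, by have := hp.pos; omega⟩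
      exact Nat.choose_succ_succ _ _
    have h2 : ((p.choose (k + 1) : ℕ) : K) = 0 :=
      (CharP.cast_eq_zero_iff K p _).2 (hp.dvd_choose_self (by omega) (by omega))
    rw [h1, Nat.cast_add, ih (by omega)] at h2
    rw [pow_succ]
    linear_combination h2

theorem aux_homog {K : Type*} [Field K] (A B : K) (m r s : ℕ) (hrs : r + s = 3 * m)
    (e : Fin 4 →₀ ℕ) (he : e = Finsupp.equivFunOnFinite.symm ![r, 0, s, 0]) :
    coeff e ((X 0 ^ 3 + C A * X 0 * X 2 ^ 2 + C B * X 2 ^ 3 : MvPolynomial (Fin 4) K) ^ m) =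
      Polynomial.coeff
        ((Polynomial.X ^ 3 + Polynomial.C A * Polynomial.X + Polynomial.C B) ^ m) r := by
  have hinj : Function.Injective (![0, 2] : Fin 2 → Fin 4) := by decide
  set f : Polynomial K := Polynomial.X ^ 3 + Polynomial.C A * Polynomial.X + Polynomial.C B with hf
  have hdeg : f.natDegree ≤ 3 := by rw [hf]; compute_degree
  have h1 : (X 0 ^ 3 + C A * X 0 * X 2 ^ 2 + C B * X 2 ^ 3 : MvPolynomial (Fin 4) K) =
      rename ![0, 2] (f.homogenize 3) := by
    simp [hf, mul_assoc]
  have h2 : (f.homogenize 3) ^ m = (f ^ m).homogenize (3 * m) := by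
    have := Polynomial.homogenize_finsetProd (s := Finset.range m) (p := fun _ => f)
      (n := fun _ => 3) (fun _ _ => hdeg)
    simp only [Finset.prod_const, Finset.sum_const, Finset.card_range, smul_eq_mul] at this
    rw [mul_comm 3 m, this]
  have h3 : e = (Finsupp.equivFunOnFinite.symm ![r, s]).mapDomain (![0, 2] : Fin 2 → Fin 4) := by
    rw [he]
    ext j
    fin_cases j
    · exact (Finsupp.mapDomain_apply hinj (Finsupp.equivFunOnFinite.symm ![r, s]) 0).symm
    · exact (Finsupp.mapDomain_of_notMem_range _ _ (by simp)).symm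
    · exact (Finsupp.mapDomain_apply hinj (Finsupp.equivFunOnFinite.symm ![r, s]) 1).symm
    · exact (Finsupp.mapDomain_of_notMem_range _ _ (by simp)).symm
  rw [h1, ← map_pow, h2, h3, coeff_rename_mapDomain _ hinj, Polynomial.coeff_homogenize]
  simp [hrs]

theorem aux_X_mem {K : Type*} [Field K] (i j : Fin 4) (h : j ≠ i) :
    (X j : MvPolynomial (Fin 4) K) ∈ supported K {j : Fin 4 | j ≠ i} :=
  X_mem_supported.2 h

theorem aux_C_mem {K : Type*} [Field K] (i : Fin 4) (c : K) :
    (C c : MvPolynomial (Fin 4) K) ∈ supported K {j : Fin 4 | j ≠ i} :=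
  Subalgebra.algebraMap_mem _ c

/-- in characteristic `p ≥ 5`, the coefficient of
`x^{p−1}·y^{p−1}·z^{p−1}·w^{2p−2}` in `(P·Q)^{p−1}` equals the coefficient of `t^{p−1}` in
`(t³ + A·t + B)^{(p−1)/2}`. -/
theorem stmt11 {K : Type*} [Field K] (p : ℕ) (hp : p.Prime) (hp5 : 5 ≤ p) [CharP K p]
    (A B a0 a1 a2 a3 a4 a5 : K) :
    MvPolynomial.coeff (Finsupp.equivFunOnFinite.symm ![p - 1, p - 1, p - 1, 2 * p - 2])
        ((Pcubic K A B * Qquad K a0 a1 a2 a3 a4 a5) ^ (p - 1)) =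
      Polynomial.coeff
        ((Polynomial.X ^ 3 + Polynomial.C A * Polynomial.X + Polynomial.C B) ^ ((p - 1) / 2))
        (p - 1) := by
  obtain ⟨m, hm⟩ : ∃ m, p = 2 * m + 1 := hp.odd_of_ne_two (by omega)
  have hF : ∀ i : Fin 4, i ≠ 0 → i ≠ 2 →
      (X 0 ^ 3 + C A * X 0 * X 2 ^ 2 + C B * X 2 ^ 3 : MvPolynomial (Fin 4) K) ∈
        supported K {j : Fin 4 | j ≠ i} := by
    intro i h0 h2
    have x0 := aux_X_mem (K := K) i 0 h0.symm
    have x2 := aux_X_mem (K := K) i 2 h2.symm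
    exact add_mem (add_mem (pow_mem x0 _) (mul_mem (mul_mem (aux_C_mem i A) x0) (pow_mem x2 _)))
      (mul_mem (aux_C_mem i B) (pow_mem x2 _))
  have x0 := aux_X_mem (K := K) 3 0 (by decide)
  have x1 := aux_X_mem (K := K) 3 1 (by decide)
  have x2 := aux_X_mem (K := K) 3 2 (by decide)
  have hP : Pcubic K A B ∈ supported K {j : Fin 4 | j ≠ 3} :=
    sub_mem (mul_mem (pow_mem x1 _) x2) (hF 3 (by decide) (by decide))
  have hq : qForm K a0 a1 a2 a3 a4 a5 ∈ supported K {j : Fin 4 | j ≠ 3} := by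
    have c := aux_C_mem (K := K) 3
    exact add_mem (add_mem (add_mem (add_mem (add_mem (mul_mem (c _) (pow_mem x0 _))
      (mul_mem (mul_mem (c _) x0) x1)) (mul_mem (mul_mem (c _) x0) x2))
      (mul_mem (c _) (pow_mem x1 _))) (mul_mem (mul_mem (c _) x1) x2))
      (mul_mem (c _) (pow_mem x2 _))
  have hQ : Qquad K a0 a1 a2 a3 a4 a5 = X 3 ^ 2 * 1 + -qForm K a0 a1 a2 a3 a4 a5 := by
    rw [Qquad]; ring
  have hP' : Pcubic K A B = X 1 ^ 2 * X 2 +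
      -(X 0 ^ 3 + C A * X 0 * X 2 ^ 2 + C B * X 2 ^ 3) := by
    rw [Pcubic]; ring
  rw [mul_pow, hQ, aux_coeff_binom 3 _ _ _ (pow_mem hP _) (one_mem _) (neg_mem hq) (p - 1) (p - 1)
    le_rfl _ (by simp; omega)]
  rw [Nat.choose_self, Nat.cast_one, one_mul, one_pow, Nat.sub_self, pow_zero, one_mul, mul_one,
    ← one_mul (Pcubic K A B ^ (p - 1)), hP',
    aux_coeff_binom 1 _ _ _ (one_mem _) (aux_X_mem 1 2 (by decide))
      (neg_mem (hF 1 (by decide) (by decide))) (p - 1) m (by omega) _ (by simp; omega),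
    aux_choose p hp m (by omega), one_mul, show p - 1 - m = m by omega,
    show (p - 1) / 2 = m by omega, neg_pow (X 0 ^ 3 + C A * X 0 * X 2 ^ 2 + C B * X 2 ^ 3), X_pow_eq_monomial, coeff_monomial_mul', if_pos, one_mul,
    show ((-1 : MvPolynomial (Fin 4) K)) ^ m = C ((-1) ^ m) by simp, coeff_C_mul,
    aux_homog A B m (p - 1) m (by omega), ← mul_assoc, ← mul_pow]
  · simp
  · ext j
    fin_cases j <;> simp [Finsupp.erase, Finsupp.single_apply]
    omega
  · rw [Finsupp.single_le_iff]
    simp [Finsupp.erase]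
    omega

end
end

section
/- Let p ≥ 5 be a prime, let K be an algebraically closed field of characteristic p, and fix A, B, a0, a1, a2, a3, a4, a5 ∈ K. If all sixteen entries of the Hasse–Witt matrix of C = V(P,Q) vanish, i.e., for all 1 ≤ i, j ≤ 4 the coefficient of x^{p·e_{i1}−e_{j1}}·y^{p·e_{i2}−e_{j2}}·z^{p·e_{i3}−e_{j3}}·w^{p·e_{i4}−e_{j4}} in (P·Q)^{p−1} is zero, then the coefficient of t^{p−1} in (t³ + A·t + B)^{(p−1)/2} ∈ K[t] is zero (i.e., by Deuring's criterion, the elliptic curve y² = x³ + Ax + B is supersingular). -/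
open MvPolynomial

noncomputable section

/-- The exponent matrix `(e_{ij})` with rows `(1,1,1,2), (1,1,2,1), (1,2,0,1), (2,1,1,1)`. -/
def eMat : Fin 4 → Fin 4 → ℕ :=
  ![![1, 1, 1, 2], ![1, 1, 2, 1], ![1, 2, 0, 1], ![2, 1, 1, 1]]

/-- The Hasse–Witt matrix of `C = V(P,Q)` vanishes: the coefficient of
`x^{p·e_{i1}−e_{j1}}·y^{p·e_{i2}−e_{j2}}·z^{p·e_{i3}−e_{j3}}·w^{p·e_{i4}−e_{j4}}` in
`(P·Q)^{p−1}` is zero for all `i, j` (the guard handles the entries whose exponent vector has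
a negative component, for which the coefficient is zero trivially). -/
def HasseWittVanishes {K : Type*} [Field K] (p : ℕ) (P Q : MvPolynomial (Fin 4) K) : Prop :=
  ∀ i j : Fin 4, (∀ k : Fin 4, eMat j k ≤ p * eMat i k) →
    MvPolynomial.coeff (Finsupp.equivFunOnFinite.symm fun k => p * eMat i k - eMat j k)
      ((P * Q) ^ (p - 1)) = 0

/-- Dehomogenization `x ↦ t, y ↦ Y, z ↦ 1, w ↦ W` into `K[t][Y][W]`. -/
def deh (K : Type*) [CommRing K] :
    MvPolynomial (Fin 4) K →+* Polynomial (Polynomial (Polynomial K)) :=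
  eval₂Hom (R := K) (S₁ := Polynomial (Polynomial (Polynomial K))) (σ := Fin 4)
    ((Polynomial.C : Polynomial (Polynomial K) →+* _).comp
      ((Polynomial.C : Polynomial K →+* _).comp (Polynomial.C : K →+* _)))
    ![Polynomial.C (Polynomial.C Polynomial.X), Polynomial.C Polynomial.X, 1, Polynomial.X]

lemma deh_C {K : Type*} [CommRing K] (c : K) :
    deh K (C c) = Polynomial.C (Polynomial.C (Polynomial.C c)) := by
  rw [deh, coe_eval₂Hom, eval₂_C]; rfl

lemma deh_X {K : Type*} [CommRing K] (i : Fin 4) :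
    deh K (X i) = ![Polynomial.C (Polynomial.C Polynomial.X), Polynomial.C Polynomial.X, 1,
      Polynomial.X] i := by
  rw [deh, coe_eval₂Hom, eval₂_X]

lemma deh_monomial {K : Type*} [CommRing K] (s : Fin 4 →₀ ℕ) (c : K) (a b d : ℕ) :
    (((deh K (monomial s c)).coeff d).coeff b).coeff a
      = if s 0 = a ∧ s 1 = b ∧ s 3 = d then c else 0 := by
  have h : deh K (monomial s c) = Polynomial.monomial (s 3) (Polynomial.monomial (s 1)
      (Polynomial.monomial (s 0) c)) := by
    rw [deh, coe_eval₂Hom, eval₂_monomial, Finsupp.prod_fintype _ _ (by simp)]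
    simp only [Fin.prod_univ_four, ← Polynomial.C_mul_X_pow_eq_monomial]
    simp
    ring
  rw [h]
  simp only [Polynomial.coeff_monomial]
  by_cases h3 : s 3 = d <;> by_cases h1 : s 1 = b <;> by_cases h0 : s 0 = a <;>
    simp [h3, h1, h0, Polynomial.coeff_monomial]

lemma deh_coeff {K : Type*} [CommRing K] (F : MvPolynomial (Fin 4) K) (N : ℕ)
    (hF : F.IsHomogeneous N) (u : Fin 4 →₀ ℕ) (hu : u 0 + u 1 + u 2 + u 3 = N) :
    (((deh K F).coeff (u 3)).coeff (u 1)).coeff (u 0) = F.coeff u := by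
  conv_lhs => rw [F.as_sum]
  simp only [map_sum, Polynomial.finsetSum_coeff, deh_monomial]
  have : ∀ s ∈ F.support, (if s 0 = u 0 ∧ s 1 = u 1 ∧ s 3 = u 3 then F.coeff s else 0)
      = if s = u then F.coeff s else 0 := by
    intro s hs
    congr 1
    have h1 := hF (mem_support_iff.mp hs)
    rw [Finsupp.weight_apply, Finsupp.sum_fintype _ _ (by simp)] at h1
    simp [Fin.sum_univ_four] at h1
    apply propext
    constructor
    · rintro ⟨h0, h2, h3⟩
      ext i
      fin_cases i <;> simp <;> omega
    · rintro rfl; simp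
  rw [Finset.sum_congr rfl this, Finset.sum_ite_eq']
  split_ifs with h
  · rfl
  · exact (notMem_support_iff.mp h).symm

lemma Pcubic_hom {K : Type*} [Field K] (A B : K) : (Pcubic K A B).IsHomogeneous 3 := by
  unfold Pcubic
  refine IsHomogeneous.sub ?_ (IsHomogeneous.add (IsHomogeneous.add ?_ ?_) ?_)
  · exact (isHomogeneous_X_pow 1 2).mul (isHomogeneous_X K 2)
  · exact isHomogeneous_X_pow 0 3
  · exact ((isHomogeneous_C _ A).mul (isHomogeneous_X K 0)).mul (isHomogeneous_X_pow 2 2)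
  · exact (isHomogeneous_C _ B).mul (isHomogeneous_X_pow 2 3)

lemma Qquad_hom {K : Type*} [Field K] (a0 a1 a2 a3 a4 a5 : K) :
    (Qquad K a0 a1 a2 a3 a4 a5).IsHomogeneous 2 := by
  have h2 : ∀ (a : K) (i : Fin 4), (C a * X i ^ 2 : MvPolynomial (Fin 4) K).IsHomogeneous 2 :=
    fun a i => (isHomogeneous_C _ a).mul (isHomogeneous_X_pow i 2)
  have h11 : ∀ (a : K) (i j : Fin 4),
      (C a * X i * X j : MvPolynomial (Fin 4) K).IsHomogeneous 2 :=
    fun a i j => ((isHomogeneous_C _ a).mul (isHomogeneous_X K i)).mul (isHomogeneous_X K j)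
  unfold Qquad qForm
  exact (isHomogeneous_X_pow 3 2).sub
    ((((((h2 _ _).add (h11 _ _ _)).add (h11 _ _ _)).add (h2 _ _)).add (h11 _ _ _)).add (h2 _ _))

lemma top_coeff {R : Type*} [CommRing R] [Nontrivial R] (q : R) (n : ℕ) :
    ((Polynomial.X ^ 2 - Polynomial.C q) ^ n).coeff (2 * n) = 1 := by
  have hm := Polynomial.monic_X_pow_sub_C q (n := 2) (by norm_num)
  have h := (hm.pow n).coeff_natDegree
  rwa [hm.natDegree_pow, Polynomial.natDegree_X_pow_sub_C, mul_comm] at h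

lemma mid_coeff {R : Type*} [CommRing R] (f : R) (n m : ℕ) :
    ((Polynomial.X ^ 2 - Polynomial.C f) ^ n).coeff (2 * m)
      = (-f) ^ (n - m) * (n.choose m : R) := by
  have : (Polynomial.X ^ 2 - Polynomial.C f) ^ n
      = Polynomial.expand R 2 ((Polynomial.X + Polynomial.C (-f)) ^ n) := by
    simp [sub_eq_add_neg]
  rw [this, Polynomial.coeff_expand_mul' (by norm_num), Polynomial.coeff_X_add_C_pow]

/-- if all entries of the Hasse–Witt matrix of `C = V(P,Q)` vanish, then the
coefficient of `t^{p−1}` in `(t³ + A·t + B)^{(p−1)/2}` is zero (Deuring's criterion: the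
elliptic curve `y² = x³ + Ax + B` is supersingular). -/
theorem stmt12 {K : Type*} [Field K] [IsAlgClosed K] (p : ℕ) (hp : p.Prime) (hp5 : 5 ≤ p)
    [CharP K p] (A B a0 a1 a2 a3 a4 a5 : K)
    (hHW : HasseWittVanishes p (Pcubic K A B) (Qquad K a0 a1 a2 a3 a4 a5)) :
    Polynomial.coeff
        ((Polynomial.X ^ 3 + Polynomial.C A * Polynomial.X + Polynomial.C B) ^ ((p - 1) / 2))
        (p - 1) = 0 := by
  obtain ⟨m, hm⟩ : ∃ m, p = 2 * m + 1 := hp.odd_of_ne_two (by omega)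
  have h := hHW 0 0 (fun k => Nat.le_mul_of_pos_left _ hp.pos)
  have hn : p - 1 = 2 * m := by omega
  have hm' : (p - 1) / 2 = m := by omega
  rw [hm', hn]
  rw [← deh_coeff _ _ (((Pcubic_hom A B).mul (Qquad_hom a0 a1 a2 a3 a4 a5)).pow (p - 1)) _
    (by simp [eMat]; omega)] at h
  simp only [Finsupp.equivFunOnFinite_symm_apply_apply, eMat, Matrix.cons_val] at h
  have e1 : p * 2 - 2 = 2 * (2 * m) := by omega
  have e2 : p * 1 - 1 = 2 * m := by omega
  rw [e1, e2, hn] at h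
  have hP : deh K (Pcubic K A B) = Polynomial.C (Polynomial.X ^ 2 - Polynomial.C
      (Polynomial.X ^ 3 + Polynomial.C A * Polynomial.X + Polynomial.C B)) := by
    simp [Pcubic, deh_C, deh_X]
  obtain ⟨q, hQ⟩ : ∃ q, deh K (Qquad K a0 a1 a2 a3 a4 a5)
      = Polynomial.X ^ 2 - Polynomial.C q := by
    refine ⟨Polynomial.C (Polynomial.C a0 * Polynomial.X ^ 2)
      + Polynomial.C (Polynomial.C a1 * Polynomial.X) * Polynomial.X
      + Polynomial.C (Polynomial.C a2 * Polynomial.X)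
      + Polynomial.C (Polynomial.C a3) * Polynomial.X ^ 2
      + Polynomial.C (Polynomial.C a4) * Polynomial.X
      + Polynomial.C (Polynomial.C a5), ?_⟩
    simp [Qquad, qForm, deh_C, deh_X]
    try ring
  rw [mul_pow, map_mul, map_pow, map_pow, hP, hQ, ← Polynomial.C_pow, Polynomial.coeff_C_mul, top_coeff,
    mul_one, mid_coeff, show 2 * m - m = m by omega, neg_pow,
    mul_comm, ← Polynomial.C_eq_natCast, Polynomial.coeff_C_mul,
    show (-1 : Polynomial K) ^ m = Polynomial.C ((-1) ^ m) by simp, Polynomial.coeff_C_mul] at h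
  have hc : ((2 * m).choose m : K) ≠ 0 := by
    rw [Ne, CharP.cast_eq_zero_iff K p]
    intro hd
    have h1 : p ∣ (2 * m).factorial := by
      rw [← Nat.choose_mul_factorial_mul_factorial (show m ≤ 2 * m by omega), mul_assoc]
      exact hd.mul_right _
    have := hp.dvd_factorial.mp h1
    omega
  rcases mul_eq_zero.mp h with h | h
  · exact absurd h hc
  · exact (mul_eq_zero.mp h).resolve_left (by simp)

end
end

section
/- Let K be the algebraic closure of F_11 and set P := y²z − (x³ + z³) and Q := w² − x·y in K[x,y,z,w]. Then the projective curve C = V(P,Q) ⊂ ℙ³(K) is nonsingular, and for all 1 ≤ i, j ≤ 4 the coefficient of x^{11·e_{i1}−e_{j1}}·y^{11·e_{i2}−e_{j2}}·z^{11·e_{i3}−e_{j3}}·w^{11·e_{i4}−e_{j4}} in (P·Q)^{10} is zero; that is, the Hasse–Witt matrix of C vanishes, so C is a superspecial genus-4 curve in characteristic 11. -/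
open MvPolynomial

noncomputable section

instance : Fact (Nat.Prime 11) := ⟨by norm_num⟩

/-- The algebraic closure of `F_11`. -/
abbrev K11 := AlgebraicClosure (ZMod 11)

/-- `P = y²z − (x³ + z³)` over the algebraic closure of `F_11`. -/
def P11 : MvPolynomial (Fin 4) K11 :=
  X 1 ^ 2 * X 2 - (X 0 ^ 3 + X 2 ^ 3)

/-- `Q = w² − x·y` over the algebraic closure of `F_11`. -/
def Q11 : MvPolynomial (Fin 4) K11 :=
  X 3 ^ 2 - X 0 * X 1

lemma supp_P (m : Fin 4 →₀ ℕ) (h : m ∈ P11.support) :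
    ∃ a b c : ℕ, a + b + c = 1 ∧ m 0 = 3 * b ∧ m 1 = 2 * a ∧ m 2 = a + 3 * c ∧ m 3 = 0 := by
  classical
  have e : P11 = monomial (Finsupp.single 1 2 + Finsupp.single 2 1) 1
      - (monomial (Finsupp.single 0 3) 1 + monomial (Finsupp.single 2 3) 1) := by
    simp [P11, X, monomial_pow, monomial_mul]
  rw [mem_support_iff, e] at h
  simp only [coeff_sub, coeff_add, coeff_monomial] at h
  by_cases h1 : (Finsupp.single 1 2 + Finsupp.single 2 1 : Fin 4 →₀ ℕ) = m
  · exact ⟨1, 0, 0, by subst h1; simp⟩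
  by_cases h2 : (Finsupp.single 0 3 : Fin 4 →₀ ℕ) = m
  · exact ⟨0, 1, 0, by subst h2; simp⟩
  by_cases h3 : (Finsupp.single 2 3 : Fin 4 →₀ ℕ) = m
  · exact ⟨0, 0, 1, by subst h3; simp⟩
  simp [h1, h2, h3] at h

lemma supp_Q (m : Fin 4 →₀ ℕ) (h : m ∈ Q11.support) :
    ∃ d e : ℕ, d + e = 1 ∧ m 0 = e ∧ m 1 = e ∧ m 2 = 0 ∧ m 3 = 2 * d := by
  classical
  have e : Q11 = monomial (Finsupp.single 3 2) 1
      - monomial (Finsupp.single 0 1 + Finsupp.single 1 1) 1 := by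
    simp [Q11, X, monomial_pow, monomial_mul]
  rw [mem_support_iff, e] at h
  simp only [coeff_sub, coeff_monomial] at h
  by_cases h1 : (Finsupp.single 3 2 : Fin 4 →₀ ℕ) = m
  · exact ⟨1, 0, by subst h1; simp⟩
  by_cases h2 : (Finsupp.single 0 1 + Finsupp.single 1 1 : Fin 4 →₀ ℕ) = m
  · exact ⟨0, 1, by subst h2; simp⟩
  simp [h1, h2] at h

lemma supp_pow (n : ℕ) : ∀ m : Fin 4 →₀ ℕ, m ∈ ((P11 * Q11) ^ n).support →
    ∃ a b c d e : ℕ, a + b + c = n ∧ d + e = n ∧ m 0 = 3 * b + e ∧ m 1 = 2 * a + e ∧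
      m 2 = a + 3 * c ∧ m 3 = 2 * d := by
  classical
  induction n with
  | zero =>
    intro m h
    have h0 : m = 0 := by
      by_contra hne
      rw [mem_support_iff, pow_zero, coeff_one, if_neg (Ne.symm hne)] at h
      exact h rfl
    exact ⟨0, 0, 0, 0, 0, by subst h0; simp⟩
  | succ n ih =>
    intro m h
    rw [pow_succ] at h
    obtain ⟨u, hu, v, hv, rfl⟩ := Finset.mem_add.1 (support_mul _ _ h)
    obtain ⟨s, hs, t, ht, rfl⟩ := Finset.mem_add.1 (support_mul _ _ hv)
    obtain ⟨a, b, c, d, e, h1⟩ := ih u hu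
    obtain ⟨a', b', c', h2⟩ := supp_P s hs
    obtain ⟨d', e', h3⟩ := supp_Q t ht
    refine ⟨a + a', b + b', c + c', d + d', e + e', ?_⟩
    simp only [Finsupp.add_apply]
    omega

lemma hw : HasseWittVanishes 11 P11 Q11 := by
  intro i j _
  by_contra h
  obtain ⟨a, b, c, d, e, h1, h2, h3, h4, h5, h6⟩ := supp_pow _ _ (mem_support_iff.2 h)
  clear h
  simp only [Finsupp.equivFunOnFinite_symm_apply_apply] at h3 h4 h5 h6
  fin_cases i <;> fin_cases j <;> simp [eMat] at h3 h4 h5 h6 <;> omega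

lemma two_ne : (2 : K11) ≠ 0 := by
  intro h
  have : ((2 : ℕ) : K11) = 0 := by exact_mod_cast h
  rw [CharP.cast_eq_zero_iff K11 11] at this
  omega

lemma three_ne : (3 : K11) ≠ 0 := by
  intro h
  have : ((3 : ℕ) : K11) = 0 := by exact_mod_cast h
  rw [CharP.cast_eq_zero_iff K11 11] at this
  omega

lemma alg (x y z w a b : K11) (hP : y ^ 2 * z - (x ^ 3 + z ^ 3) = 0) (hQ : w ^ 2 - x * y = 0)
    (h0 : a * (3 * x ^ 2) + b * y = 0) (h1 : a * (2 * y * z) - b * x = 0)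
    (h2 : a * (y ^ 2 - 3 * z ^ 2) = 0) (h3 : b * (2 * w) = 0)
    (hv : ¬ (x = 0 ∧ y = 0 ∧ z = 0 ∧ w = 0)) : a = 0 ∧ b = 0 := by
  have t2 := two_ne
  have t3 := three_ne
  have hb : b = 0 := by
    by_contra hb
    have hw : w = 0 := by simpa [hb, t2] using h3
    subst hw
    have hxy : x = 0 ∨ y = 0 := by
      rw [← mul_eq_zero]; linear_combination -hQ
    rcases hxy with rfl | rfl
    · have hy : y = 0 := by simpa [hb] using h0
      subst hy
      have hz : z = 0 := by simpa using hP
      exact hv ⟨rfl, rfl, hz, rfl⟩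
    · have hx : x = 0 := by simpa [hb] using h1
      subst hx
      have hz : z = 0 := by simpa using hP
      exact hv ⟨rfl, rfl, hz, rfl⟩
  subst hb
  refine ⟨?_, rfl⟩
  by_contra ha
  have hx : x = 0 := by simpa [ha, t3] using h0
  subst hx
  have hw : w = 0 := by simpa using hQ
  have hyz : y = 0 ∨ z = 0 := by simpa [ha, t2] using h1
  rcases hyz with rfl | rfl
  · have hz : z = 0 := by simpa using hP
    exact hv ⟨rfl, rfl, hz, hw⟩
  · have hy : y = 0 := by simpa [ha] using h2
    exact hv ⟨rfl, hy, rfl, hw⟩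

lemma nonsing (v : Fin 4 → K11) (hv : v ≠ 0) (hP : eval v P11 = 0) (hQ : eval v Q11 = 0) :
    ¬ (jacMat P11 Q11 v).rank ≤ 1 := by
  have hli : LinearIndependent K11 (jacMat P11 Q11 v).row := by
    rw [Fintype.linearIndependent_iff]
    intro g hg
    have k := fun i => congrFun hg i
    have k0 := k 0
    have k1 := k 1
    have k2 := k 2
    have k3 := k 3
    simp [Fin.sum_univ_two, jacMat, P11, Q11, pderiv_X, Pi.single_apply, Matrix.row] at k0 k1 k2 k3
    simp [P11, Q11] at hP hQ
    have key := alg (v 0) (v 1) (v 2) (v 3) (g 0) (g 1) hP hQ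
      (by linear_combination -k0) (by linear_combination k1)
      (mul_eq_zero.2 k2) (by rw [mul_eq_zero, mul_eq_zero]; exact k3)
      (by
        rintro ⟨q0, q1, q2, q3⟩
        apply hv
        funext i
        fin_cases i <;> simp [*])
    intro i
    fin_cases i
    · exact key.1
    · exact key.2
  rw [hli.rank_matrix]
  simp

/-- over the algebraic closure of `F_11`, the curve
`C = V(y²z − (x³+z³), w² − xy)` is nonsingular and its Hasse–Witt matrix vanishes;
`C` is a superspecial genus-4 curve in characteristic 11. -/
theorem stmt13 :
    (∀ v : Fin 4 → K11, v ≠ 0 → eval v P11 = 0 → eval v Q11 = 0 →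
        ¬ (jacMat P11 Q11 v).rank ≤ 1) ∧
      HasseWittVanishes 11 P11 Q11 := by
  exact ⟨nonsing, hw⟩

end
end
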